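/- Let M be a finite dimensional indecomposable left H_{mn}(ξ)-module and let J be the Jacobson radical of H_{mn}(ξ). If the Loewy length of M is 1 (i.e. J·M = 0), then either M ≅ M(l,i) for some 1 ≤ l ≤ n−1 and i ∈ ℤ_{mn}, or M ≅ Z(λ_{ij}) for some (i,j) ∈ I_0. If the Loewy length of M is 3 (i.e. J²·M ≠ 0 and J³·M = 0), then M ≅ P(l,i) for some 1 ≤ l ≤ n−1 and i ∈ ℤ_{mn}. -/

import Mathlib

noncomputable section

namespace Radford

variable (𝕜 : Type) [Field 𝕜]

/-- The q-integer `(k)_q = 1 + q + ⋯ + q^(k-1)`. -/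
def qInt (q : 𝕜) (k : ℕ) : 𝕜 := ∑ j ∈ Finset.range k, q ^ j

/-- The q-factorial `(k)!_q = (1)_q (2)_q ⋯ (k)_q`. -/
def qFact (q : 𝕜) : ℕ → 𝕜
  | 0 => 1
  | k + 1 => qFact q k * qInt 𝕜 q (k + 1)

variable (m n : ℕ) (ξ : 𝕜)

/-- Generators of the free algebra: 0 ↦ a, 1 ↦ b, 2 ↦ c, 3 ↦ d. -/
def fgen (k : Fin 4) : FreeAlgebra 𝕜 (Fin 4) := FreeAlgebra.ι 𝕜 k

local notation "fa" => fgen 𝕜 0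
local notation "fb" => fgen 𝕜 1
local notation "fc" => fgen 𝕜 2
local notation "fd" => fgen 𝕜 3

/-- The defining relations of the Drinfeld double `H_{mn}(ξ) = D(R_{mn}(q))`, where `q = ξ^m`. -/
inductive HRel : FreeAlgebra 𝕜 (Fin 4) → FreeAlgebra 𝕜 (Fin 4) → Prop
  | aPow : HRel (fa ^ n) (fb ^ n - 1)
  | bPow : HRel (fb ^ (m * n)) 1
  | cPow : HRel (fc ^ (m * n)) 1
  | dPow : HRel (fd ^ n) 0
  | ab : HRel (fa * fb) (ξ ^ m • (fb * fa))
  | dc : HRel (fd * fc) (ξ • (fc * fd))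
  | bc : HRel (fb * fc) (fc * fb)
  | bd : HRel (fb * fd) (ξ ^ m • (fd * fb))
  | ad : HRel (fa * fd - fd * fa) (fb - fc ^ m)
  | ac : HRel (fa * fc)
      (ξ⁻¹ • (fc * fa) +
        ((ξ⁻¹ - ξ ^ (n - 1)) / qFact 𝕜 (ξ ^ m) (n - 1)) •
          ((fc ^ (m + 1) - ξ ^ m • (fb * fc)) * fd ^ (n - 1)))

/-- The Drinfeld double `H_{mn}(ξ)` of the Radford Hopf algebra `R_{mn}(q)`, presented by
generators `a, b, c, d` and the above relations. -/
def H := RingQuot (HRel 𝕜 m n ξ)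

instance : Ring (H 𝕜 m n ξ) := inferInstanceAs (Ring (RingQuot (HRel 𝕜 m n ξ)))

instance : Algebra 𝕜 (H 𝕜 m n ξ) := inferInstanceAs (Algebra 𝕜 (RingQuot (HRel 𝕜 m n ξ)))

/-- The generators `a, b, c, d` of `H_{mn}(ξ)` (indexed by 0,1,2,3). -/
def gen (k : Fin 4) : H 𝕜 m n ξ := RingQuot.mkAlgHom 𝕜 (HRel 𝕜 m n ξ) (fgen 𝕜 k)

local notation "ha" => gen 𝕜 m n ξ 0
local notation "hb" => gen 𝕜 m n ξ 1
local notation "hc" => gen 𝕜 m n ξ 2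
local notation "hd" => gen 𝕜 m n ξ 3

/-- The Jacobson radical `J` of `H_{mn}(ξ)`. -/
def jrad : Ideal (H 𝕜 m n ξ) := Ideal.jacobson ⊥

/-- The scalars `α_k(l,i)`;  `alph l i k` is `α_k(l,i)`, where `q = ξ^m`. -/
def alph (l : ℕ) (i : ℤ) (k : ℕ) : 𝕜 :=
  if k = n then ((ξ ^ m) ^ (i + (l : ℤ)) - (ξ ^ m) ^ i) / qFact 𝕜 (ξ ^ m) (n - 1)
  else qInt 𝕜 (ξ ^ m) k * ((ξ ^ m) ^ i - (ξ ^ m) ^ (i + (l : ℤ) - (k : ℤ)))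

/-- The scalars `γ_k(l,i)`;  `gam l i k` is `γ_k(l,i)`, where `q = ξ^m`. -/
def gam (l : ℕ) (i : ℤ) (k : ℕ) : 𝕜 :=
  if k = n then ((ξ ^ m) ^ i - (ξ ^ m) ^ (i + (l : ℤ))) / qFact 𝕜 (ξ ^ m) (n - 1)
  else qInt 𝕜 (ξ ^ m) k * ((ξ ^ m) ^ (i + (l : ℤ)) - (ξ ^ m) ^ (i - (k : ℤ)))

section ModuleH

variable {W : Type} [AddCommGroup W] [Module (H 𝕜 m n ξ) W]

variable (W) in
/-- The socle of an `H`-module: the sum of all simple submodules. -/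
def socle : Submodule (H 𝕜 m n ξ) W :=
  sSup {N : Submodule (H 𝕜 m n ξ) W | IsSimpleModule (H 𝕜 m n ξ) N}

variable (W) in
/-- The submodule `J•W`, the radical of `W`. -/
def radM : Submodule (H 𝕜 m n ξ) W :=
  Submodule.span (H 𝕜 m n ξ) {x | ∃ r ∈ jrad 𝕜 m n ξ, ∃ w : W, x = r • w}

variable (W) in
/-- The submodule `J²•W`. -/
def rad2M : Submodule (H 𝕜 m n ξ) W :=
  Submodule.span (H 𝕜 m n ξ)
    {x | ∃ r ∈ jrad 𝕜 m n ξ, ∃ s ∈ jrad 𝕜 m n ξ, ∃ w : W, x = r • s • w}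

variable (W) in
/-- The submodule `J³•W`. -/
def rad3M : Submodule (H 𝕜 m n ξ) W :=
  Submodule.span (H 𝕜 m n ξ)
    {x | ∃ r ∈ jrad 𝕜 m n ξ, ∃ s ∈ jrad 𝕜 m n ξ, ∃ t ∈ jrad 𝕜 m n ξ, ∃ w : W, x = r • s • t • w}

variable (W) in
/-- `lengthIs c W` : the `H`-module `W` has a composition series of length `c`
(hence, by Jordan–Hölder, has composition length `c`). -/
def lengthIs (c : ℕ) : Prop :=
  ∃ s : CompositionSeries (Submodule (H 𝕜 m n ξ) W), s.head = ⊥ ∧ s.last = ⊤ ∧ s.length = c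

variable (W) in
/-- An `H`-module is indecomposable if it is nonzero and is not the direct sum of two
nonzero submodules. -/
def Indec : Prop :=
  Nontrivial W ∧ ∀ N₁ N₂ : Submodule (H 𝕜 m n ξ) W, IsCompl N₁ N₂ → N₁ = ⊥ ∨ N₂ = ⊥

variable (W) in
/-- `W` has Loewy length 2: `J•W ≠ 0` and `J²•W = 0`. -/
def LoewyLen2 : Prop := radM 𝕜 m n ξ W ≠ ⊥ ∧ rad2M 𝕜 m n ξ W = ⊥

variable (W) in
/-- `W` is of `(s,t)`-type: it has Loewy length `2`, its socle has composition length `t`,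
and `W/soc W` has composition length `s`. -/
def IsType (s t : ℕ) : Prop :=
  LoewyLen2 𝕜 m n ξ W ∧ lengthIs 𝕜 m n ξ (socle 𝕜 m n ξ W) t ∧
    lengthIs 𝕜 m n ξ (W ⧸ socle 𝕜 m n ξ W) s

end ModuleH

section ModuleK

variable {V : Type} [AddCommGroup V] [Module 𝕜 V] [Module (H 𝕜 m n ξ) V]
  [IsScalarTower 𝕜 (H 𝕜 m n ξ) V]

variable (V) in
/-- `V^d = {v ∈ V | d•v = 0}`, as a `𝕜`-subspace. -/
def dKer : Submodule 𝕜 V where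
  carrier := {v | hd • v = 0}
  add_mem' := by
    intro x y hx hy
    simp only [Set.mem_setOf_eq] at *
    rw [smul_add, hx, hy, add_zero]
  zero_mem' := smul_zero _
  smul_mem' := by
    intro r v hv
    simp only [Set.mem_setOf_eq] at *
    rw [smul_comm, hv, smul_zero]

variable (V) in
/-- `V_{(i)} = {v ∈ V | c•v = ξ^i v}`, as a `𝕜`-subspace. -/
def eigsp (i : ℤ) : Submodule 𝕜 V where
  carrier := {v | hc • v = ξ ^ i • v}
  add_mem' := by
    intro x y hx hy
    simp only [Set.mem_setOf_eq] at *
    rw [smul_add, hx, hy, smul_add]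
  zero_mem' := by simp
  smul_mem' := by
    intro r v hv
    simp only [Set.mem_setOf_eq] at *
    rw [smul_comm, hv, smul_comm]

/-- `V`, equipped with the family `mv : Fin l → V`, realizes the simple module `M(l,i)`:
`mv` is a basis of `V` and the generators act by the defining formulas of `M(l,i)`. -/
def IsMrep (l : ℕ) (i : ℤ) (mv : Fin l → V) : Prop :=
  LinearIndependent 𝕜 mv ∧ Submodule.span 𝕜 (Set.range mv) = ⊤ ∧
  (∀ (j : ℕ) (hj : j + 1 < l),
    ha • mv ⟨j, by omega⟩ = alph 𝕜 m n ξ l i (j + 1) • mv ⟨j + 1, hj⟩) ∧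
  (∀ (j : ℕ) (hj : j < l), j + 1 = l → ha • mv ⟨j, hj⟩ = 0) ∧
  (∀ j : Fin l, hb • mv j = ((ξ ^ m) ^ (i + (l : ℤ) - ((j : ℕ) + 1 : ℤ)) : 𝕜) • mv j) ∧
  (∀ j : Fin l, hc • mv j = (ξ ^ (i + (j : ℕ) : ℤ) : 𝕜) • mv j) ∧
  (∀ (j : ℕ) (hj : j + 1 < l), hd • mv ⟨j + 1, hj⟩ = mv ⟨j, by omega⟩) ∧
  (∀ hl : 0 < l, hd • mv ⟨0, hl⟩ = 0)

/-- `V` realizes the induced module `Z(λ_{ij})`: there is a cyclic vector `z` with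
`d•z = 0`, `b•z = ξ^j z`, `c•z = ξ^i z` such that `(a^k • z)_{0 ≤ k ≤ n-1}` is a basis. -/
def IsZrep (i j : ℤ) (V : Type) [AddCommGroup V] [Module 𝕜 V] [Module (H 𝕜 m n ξ) V]
    [IsScalarTower 𝕜 (H 𝕜 m n ξ) V] : Prop :=
  ∃ z : V, hd • z = 0 ∧ hb • z = (ξ ^ j : 𝕜) • z ∧ hc • z = (ξ ^ i : 𝕜) • z ∧
    LinearIndependent 𝕜 (fun k : Fin n => (ha ^ (k : ℕ)) • z) ∧
    Submodule.span 𝕜 (Set.range fun k : Fin n => (ha ^ (k : ℕ)) • z) = ⊤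

/-- `V`, equipped with the families `v u : Fin n → V`, realizes the projective module `P(l,i)`
with its standard basis. -/
def IsPrep (l : ℕ) (hl1 : 1 ≤ l) (hl2 : l < n) (i : ℤ) (v u : Fin n → V) : Prop :=
  LinearIndependent 𝕜 (Sum.elim v u) ∧
  Submodule.span 𝕜 (Set.range v ∪ Set.range u) = ⊤ ∧
  (∀ (j : ℕ) (hj : j + l + 2 ≤ n),
    ha • v ⟨j, by omega⟩ = gam 𝕜 m n ξ l i (j + 1) • v ⟨j + 1, by omega⟩) ∧
  (∀ (j : ℕ) (hj : j + 1 < n), n ≤ j + 1 + l →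
    ha • v ⟨j, by omega⟩ =
      gam 𝕜 m n ξ l i (j + 1) • v ⟨j + 1, hj⟩ + u ⟨j + 1 + l - n, by omega⟩) ∧
  (ha • v ⟨n - 1, by omega⟩ = gam 𝕜 m n ξ l i n • v ⟨0, by omega⟩ + u ⟨l, by omega⟩) ∧
  (∀ (j : ℕ) (hj : j + 1 < n),
    ha • u ⟨j, by omega⟩ = alph 𝕜 m n ξ l i (j + 1) • u ⟨j + 1, hj⟩) ∧
  (ha • u ⟨n - 1, by omega⟩ = alph 𝕜 m n ξ l i n • u ⟨0, by omega⟩) ∧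
  (∀ j : Fin n, hb • v j = ((ξ ^ m) ^ (i + (n : ℤ) - ((j : ℕ) + 1 : ℤ)) : 𝕜) • v j) ∧
  (∀ j : Fin n, hb • u j = ((ξ ^ m) ^ (i + (l : ℤ) - ((j : ℕ) + 1 : ℤ)) : 𝕜) • u j) ∧
  (∀ j : Fin n, hc • v j = (ξ ^ (i - ((n : ℤ) - (l : ℤ)) + (j : ℕ) : ℤ) : 𝕜) • v j) ∧
  (∀ j : Fin n, hc • u j = (ξ ^ (i + (j : ℕ) : ℤ) : 𝕜) • u j) ∧
  (hd • v ⟨0, by omega⟩ = 0) ∧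
  (∀ (j : ℕ) (hj : j + 1 < n), hd • v ⟨j + 1, hj⟩ = v ⟨j, by omega⟩) ∧
  (hd • u ⟨0, by omega⟩ = 0) ∧
  (∀ (j : ℕ) (hj : j + 1 < n), hd • u ⟨j + 1, hj⟩ = u ⟨j, by omega⟩)

/-- `V`, equipped with the basis `e : Fin n → V`, realizes the module `T_1(l,i)`. -/
def IsT1rep (l : ℕ) (hl1 : 1 ≤ l) (hl2 : l < n) (i : ℤ) (e : Fin n → V) : Prop :=
  LinearIndependent 𝕜 e ∧ Submodule.span 𝕜 (Set.range e) = ⊤ ∧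
  (∀ (j : ℕ) (hj : j + 1 < n),
    ha • e ⟨j, by omega⟩ = alph 𝕜 m n ξ l i (j + 1) • e ⟨j + 1, hj⟩) ∧
  (ha • e ⟨n - 1, by omega⟩ = alph 𝕜 m n ξ l i n • e ⟨0, by omega⟩) ∧
  (∀ j : Fin n, hb • e j = ((ξ ^ m) ^ (i + (l : ℤ) - ((j : ℕ) + 1 : ℤ)) : 𝕜) • e j) ∧
  (∀ j : Fin n, hc • e j = (ξ ^ (i + (j : ℕ) : ℤ) : 𝕜) • e j) ∧
  (hd • e ⟨0, by omega⟩ = 0) ∧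
  (∀ (j : ℕ) (hj : j + 1 < n), hd • e ⟨j + 1, hj⟩ = e ⟨j, by omega⟩)

/-- `V`, equipped with the basis `e : Fin n → V`, realizes the module `T̄_1(l,i)`. -/
def IsT1barrep (l : ℕ) (hl1 : 1 ≤ l) (hl2 : l < n) (i : ℤ) (e : Fin n → V) : Prop :=
  LinearIndependent 𝕜 e ∧ Submodule.span 𝕜 (Set.range e) = ⊤ ∧
  (∀ (j : ℕ) (hj : j + 1 < n - l),
    ha • e ⟨j, by omega⟩ = alph 𝕜 m n ξ (n - l) (i + l - n) (j + 1) • e ⟨j + 1, by omega⟩) ∧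
  (ha • e ⟨n - l - 1, by omega⟩ = e ⟨n - l, by omega⟩) ∧
  (∀ (k : ℕ) (hk : k + 1 < l),
    ha • e ⟨n - l + k, by omega⟩ = alph 𝕜 m n ξ l i (k + 1) • e ⟨n - l + k + 1, by omega⟩) ∧
  (ha • e ⟨n - 1, by omega⟩ = 0) ∧
  (∀ j : Fin n, hb • e j = ((ξ ^ m) ^ (i - ((j : ℕ) + 1 : ℤ)) : 𝕜) • e j) ∧
  (∀ j : Fin n, hc • e j = (ξ ^ (i + (l : ℤ) - (n : ℤ) + (j : ℕ) : ℤ) : 𝕜) • e j) ∧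
  (hd • e ⟨0, by omega⟩ = 0) ∧
  (∀ (j : ℕ) (hj : j + 1 < n - l), hd • e ⟨j + 1, by omega⟩ = e ⟨j, by omega⟩) ∧
  (hd • e ⟨n - l, by omega⟩ = 0) ∧
  (∀ (k : ℕ) (hk : k + 1 < l), hd • e ⟨n - l + k + 1, by omega⟩ = e ⟨n - l + k, by omega⟩)

end ModuleK

section Matrices

/-- The nilpotent Jordan-type matrix `D_s` with `1` on the superdiagonal. -/
def Dmat (s : ℕ) : Matrix (Fin s) (Fin s) 𝕜 :=
  fun r c => if (r : ℕ) + 1 = (c : ℕ) then 1 else 0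

/-- The matrix `X_{l,i}` : subdiagonal entries `γ_k(l,i)`, `(1,n)`-entry `γ_n(l,i)`. -/
def Xmat (l : ℕ) (i : ℤ) : Matrix (Fin n) (Fin n) 𝕜 := fun r c =>
  if (r : ℕ) = (c : ℕ) + 1 then gam 𝕜 m n ξ l i ((c : ℕ) + 1)
  else if (r : ℕ) = 0 ∧ (c : ℕ) = n - 1 then gam 𝕜 m n ξ l i n else 0

/-- The matrix `Z_{l,i}` : subdiagonal entries `α_k(l,i)`, `(1,n)`-entry `α_n(l,i)`. -/
def Zmat (l : ℕ) (i : ℤ) : Matrix (Fin n) (Fin n) 𝕜 := fun r c =>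
  if (r : ℕ) = (c : ℕ) + 1 then alph 𝕜 m n ξ l i ((c : ℕ) + 1)
  else if (r : ℕ) = 0 ∧ (c : ℕ) = n - 1 then alph 𝕜 m n ξ l i n else 0

/-- The block matrix `A(l,i) = [[X_{l,i}, 0], [D_n^{n-l-1}, Z_{l,i}]]`. -/
def Amat (l : ℕ) (i : ℤ) : Matrix (Fin n ⊕ Fin n) (Fin n ⊕ Fin n) 𝕜 :=
  Matrix.fromBlocks (Xmat 𝕜 m n ξ l i) 0 (Dmat 𝕜 n ^ (n - l - 1)) (Zmat 𝕜 m n ξ l i)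

/-- The diagonal matrix `B(l,i)`. -/
def Bmat (l : ℕ) (i : ℤ) : Matrix (Fin n ⊕ Fin n) (Fin n ⊕ Fin n) 𝕜 :=
  Matrix.fromBlocks
    (Matrix.diagonal fun j : Fin n => (ξ ^ m) ^ (i - ((j : ℕ) + 1 : ℤ))) 0 0
    (Matrix.diagonal fun j : Fin n => (ξ ^ m) ^ (i + (l : ℤ) - ((j : ℕ) + 1 : ℤ)))

/-- The diagonal matrix `C(l,i)`. -/
def Cmat (l : ℕ) (i : ℤ) : Matrix (Fin n ⊕ Fin n) (Fin n ⊕ Fin n) 𝕜 :=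
  Matrix.fromBlocks
    (Matrix.diagonal fun j : Fin n => ξ ^ (i + (l : ℤ) - (n : ℤ) + (j : ℕ))) 0 0
    (Matrix.diagonal fun j : Fin n => ξ ^ (i + (j : ℕ) : ℤ))

/-- The block matrix `D = diag(D_n, D_n)`. -/
def Dbig : Matrix (Fin n ⊕ Fin n) (Fin n ⊕ Fin n) 𝕜 :=
  Matrix.fromBlocks (Dmat 𝕜 n) 0 0 (Dmat 𝕜 n)

end Matrices

section QCommutation

variable {K R : Type*} [Field K] [Ring R] [Algebra K R]

theorem pow_mul_of_qcomm {r : K} {u v : R} (h : u * v = r • (v * u)) (k : ℕ) :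
    u ^ k * v = r ^ k • (v * u ^ k) := by
  induction k with
  | zero => simp
  | succ k ih =>
    rw [pow_succ, mul_assoc, h, mul_smul_comm, ← mul_assoc, ih, smul_mul_assoc, smul_smul,
      mul_assoc, ← pow_succ, pow_succ r, mul_comm (r ^ k)]

theorem mul_pow_of_qcomm {r : K} {u v : R} (h : u * v = r • (v * u)) (k : ℕ) :
    u * v ^ k = r ^ k • (v ^ k * u) := by
  induction k with
  | zero => simp
  | succ k ih =>
    rw [pow_succ, ← mul_assoc, ih, smul_mul_assoc, mul_assoc, h, mul_smul_comm, smul_smul,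
      mul_assoc, ← pow_succ]

theorem qcomm_symm {r : K} (hr : r ≠ 0) {u v : R} (h : u * v = r • (v * u)) :
    v * u = r⁻¹ • (u * v) := by
  rw [h, smul_smul, inv_mul_cancel₀ hr, one_smul]

/-- The relations satisfied by the generators of `H_{mn}(ξ)` once `a` has been replaced by the
element `x` which shifts the eigenvalues of `c`. -/
structure DoubleRel (m n : ℕ) (ξ : K) (x b c d : R) : Prop where
  xb : x * b = ξ ^ m • (b * x)
  xc : x * c = ξ⁻¹ • (c * x)
  dc : d * c = ξ • (c * d)
  bc : b * c = c * b
  bd : b * d = ξ ^ m • (d * b)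
  xd : x * d - d * x = b - c ^ m
  x_pow : x ^ n = 0
  d_pow : d ^ n = 0
  b_pow : b ^ (m * n) = 1
  c_pow : c ^ (m * n) = 1

theorem mul_pow_mul_pow_qcomm {x d v : R} {r s : K} (hx : x * v = r • (v * x))
    (h_d : d * v = s • (v * d)) (p t k : ℕ) :
    d ^ p * x ^ t * (v * d ^ k) = (s ^ p * r ^ t) • (v * (d ^ p * x ^ t * d ^ k)) := by
  have h1 := pow_mul_of_qcomm hx t
  have h2 := pow_mul_of_qcomm h_d p
  calc d ^ p * x ^ t * (v * d ^ k) = d ^ p * (x ^ t * v) * d ^ k := by noncomm_ring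
    _ = r ^ t • ((d ^ p * v) * x ^ t * d ^ k) := by
      rw [h1, mul_smul_comm, smul_mul_assoc]; congr 1; noncomm_ring
    _ = _ := by
      rw [h2, smul_mul_assoc, smul_mul_assoc, smul_smul, mul_comm (s ^ p)]
      congr 1; noncomm_ring

theorem exists_mul_pow_eq {x b e d : R} {r s : K} (h_b : d * b = r • (b * d))
    (he : d * e = s • (e * d)) (hxd : x * d - d * x = b - e) (k : ℕ) :
    ∃ α β : K, x * d ^ (k + 1) = d ^ (k + 1) * x + (α • b + β • e) * d ^ k := by
  induction k with
  | zero =>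
    refine ⟨1, -1, ?_⟩
    have : x * d = d * x + (b - e) := by rw [← hxd]; abel
    simp [this, sub_eq_add_neg]
  | succ k ih =>
    obtain ⟨α, β, h⟩ := ih
    have h1 : x * d = d * x + (b - e) := by rw [← hxd]; abel
    have h2 := pow_mul_of_qcomm h_b (k + 1)
    have h3 := pow_mul_of_qcomm he (k + 1)
    refine ⟨α + r ^ (k + 1), β - s ^ (k + 1), ?_⟩
    calc x * d ^ (k + 1 + 1) = (x * d ^ (k + 1)) * d := by rw [pow_succ d (k + 1), mul_assoc]
      _ = d ^ (k + 1) * (x * d) + (α • b + β • e) * d ^ (k + 1) := by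
        rw [h, add_mul, mul_assoc, mul_assoc, ← pow_succ]
      _ = d ^ (k + 1 + 1) * x + (d ^ (k + 1) * b - d ^ (k + 1) * e)
          + (α • b + β • e) * d ^ (k + 1) := by
        rw [h1, mul_add, mul_sub, ← mul_assoc, ← pow_succ]
      _ = _ := by
        rw [h2, h3, add_smul, sub_smul, add_mul, add_mul, add_mul, sub_mul]
        simp only [smul_mul_assoc]
        abel

theorem pow_mul_pow_mul_pow_eq_zero {n : ℕ} {x b e d : R} {r s r' s' : K}
    (h_b : d * b = r • (b * d)) (he : d * e = s • (e * d))
    (hb' : x * b = r' • (b * x)) (he' : x * e = s' • (e * x))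
    (hxd : x * d - d * x = b - e) (h_d : d ^ n = 0) (t p k : ℕ) (h : n + t ≤ p + k) :
    d ^ p * x ^ t * d ^ k = 0 := by
  induction t generalizing p k with
  | zero =>
    rw [pow_zero, mul_one, ← pow_add]
    exact pow_eq_zero_of_le h h_d
  | succ t ih =>
    cases k with
    | zero => rw [pow_eq_zero_of_le (by omega : n ≤ p) h_d]; simp
    | succ k =>
      obtain ⟨α, β, hαβ⟩ := exists_mul_pow_eq h_b he hxd k
      have h1 := mul_pow_mul_pow_qcomm hb' h_b p t k
      have h2 := mul_pow_mul_pow_qcomm he' he p t k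
      rw [ih p k (by omega)] at h1 h2
      simp only [mul_zero, smul_zero] at h1 h2
      rw [pow_succ, mul_assoc, mul_assoc, hαβ, mul_add, mul_add, ← mul_assoc, ← mul_assoc,
        ← mul_assoc, ih p (k + 1) (by omega), zero_mul, zero_add, ← mul_assoc, mul_assoc,
        add_mul, smul_mul_assoc, smul_mul_assoc, mul_add, mul_smul_comm, mul_smul_comm, h1, h2]
      simp

theorem exists_sub_smul_pow_eq {n : ℕ} {x D : R} (h : ∀ j, j + 2 ≤ n → D * x ^ j * D = 0)
    (k : ℕ) (hk : k ≤ n) :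
    ∃ S : R, (∀ j, k + j + 1 ≤ n → D * x ^ j * S = 0) ∧
      ∀ t : K, (x - t • D) ^ k = x ^ k - t • S := by
  induction k with
  | zero => exact ⟨0, by simp, by simp⟩
  | succ k ih =>
    obtain ⟨S, hS, hS'⟩ := ih (by omega)
    refine ⟨x * S + D * x ^ k, fun j hj => ?_, fun t => ?_⟩
    · have h1 := hS (j + 1) (by omega)
      have h2 := h j (by omega)
      rw [pow_succ] at h1
      rw [mul_add, ← mul_assoc _ D, h2, zero_mul, add_zero, mul_assoc, ← mul_assoc _ x, ← mul_assoc]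
      rw [← mul_assoc] at h1
      simpa [mul_assoc] using h1
    · have h1 := hS 0 (by omega)
      rw [pow_zero, mul_one] at h1
      rw [pow_succ', hS', sub_mul, mul_sub, mul_sub, smul_mul_assoc, smul_mul_assoc,
        mul_smul_comm, mul_smul_comm, h1, ← pow_succ', smul_add]
      simp only [smul_zero]
      abel

theorem pow_eq_zero_of_sub_pow {n : ℕ} {ξ : K} (hξ : ξ ^ n ≠ 1) (hξ0 : ξ ≠ 0) {x D c f : R}
    (h_c : IsUnit c)
    (h : ∀ j, j + 2 ≤ n → D * x ^ j * D = 0) (hx : x * c = ξ⁻¹ • (c * x))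
    (hD : D * c = (ξ⁻¹ * ξ ^ n) • (c * D)) (hf : (x - D) ^ n = f) (hfc : f * c = c * f) :
    x ^ n = 0 := by
  obtain ⟨S, -, hS⟩ := exists_sub_smul_pow_eq (K := K) h n le_rfl
  have h1 := hS 1
  rw [one_smul, one_smul, hf] at h1
  have h2 : SemiconjBy c (ξ⁻¹ • (x - ξ ^ n • D)) (x - D) := by
    unfold SemiconjBy
    rw [sub_mul, hx, hD, mul_smul_comm, mul_sub, smul_sub, mul_smul_comm, smul_smul]
  have h3 := h2.pow_right n
  rw [hf, SemiconjBy, hfc, h_c.mul_right_inj, smul_pow, hS, h1, inv_pow,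
    inv_smul_eq_iff₀ (pow_ne_zero n hξ0), smul_sub, sub_left_inj] at h3
  have h4 : (1 - ξ ^ n) • x ^ n = 0 := by rw [sub_smul, one_smul, ← h3, sub_self]
  exact (smul_eq_zero.mp h4).resolve_left (sub_ne_zero.mpr (Ne.symm hξ))

end QCommutation

section Generators

variable {K R : Type*} [Field K] [Ring R] [Algebra K R]

theorem DoubleRel.finite {m n : ℕ} {ξ : K} {x b c d : R} (h : DoubleRel m n ξ x b c d)
    (hξ0 : ξ ≠ 0) (hmn : 0 < m * n)
    (hgen : Algebra.adjoin K {x, b, c, d} = ⊤) : Module.Finite K R := by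
  set S : Submodule K R := Submodule.span K (Set.range fun p : Fin (m * n) × Fin (m * n) ×
    Fin n × Fin n => c ^ (p.1 : ℕ) * b ^ (p.2.1 : ℕ) * (x ^ (p.2.2.1 : ℕ) * d ^ (p.2.2.2 : ℕ)))
    with hS
  have mem : ∀ i j k l : ℕ, c ^ i * b ^ j * (x ^ k * d ^ l) ∈ S := by
    intro i j k l
    by_cases hk : n ≤ k
    · simp [pow_eq_zero_of_le hk h.x_pow]
    by_cases hl : n ≤ l
    · simp [pow_eq_zero_of_le hl h.d_pow]
    rw [pow_eq_pow_mod i h.c_pow, pow_eq_pow_mod j h.b_pow]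
    exact Submodule.subset_span ⟨(⟨i % (m * n), Nat.mod_lt _ hmn⟩, ⟨j % (m * n), Nat.mod_lt _ hmn⟩,
      ⟨k, by omega⟩, ⟨l, by omega⟩), rfl⟩
  have hb' : d * b = (ξ ^ m)⁻¹ • (b * d) := qcomm_symm (pow_ne_zero _ hξ0) h.bd
  have hcx : x * c ^ m = (ξ⁻¹) ^ m • (c ^ m * x) := mul_pow_of_qcomm h.xc m
  have hbc : ∀ i j, b ^ j * c ^ i = c ^ i * b ^ j := fun i j =>
    ((show Commute b c from h.bc).pow_pow j i)
  have stable : ∀ y ∈ ({x, b, c, d} : Set R), ∀ s ∈ S, y * s ∈ S := by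
    intro y hy s hs
    induction hs using Submodule.span_induction with
    | zero => simp
    | add u v _ _ hu hv => rw [mul_add]; exact S.add_mem hu hv
    | smul r u _ hu => rw [mul_smul_comm]; exact S.smul_mem _ hu
    | mem s hs =>
      obtain ⟨⟨i, j, k, l⟩, rfl⟩ := hs
      dsimp only
      generalize (i : ℕ) = i
      generalize (j : ℕ) = j
      generalize (k : ℕ) = k
      generalize (l : ℕ) = l
      simp only [Set.mem_insert_iff, Set.mem_singleton_iff] at hy
      rcases hy with rfl | rfl | rfl | rfl
      · have h1 := mul_pow_of_qcomm h.xc i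
        have h2 := mul_pow_of_qcomm h.xb j
        have : y * (c ^ i * b ^ j * (y ^ k * d ^ l)) =
            (ξ⁻¹ ^ i * (ξ ^ m) ^ j) • (c ^ i * b ^ j * (y ^ (k + 1) * d ^ l)) := by
          rw [← mul_assoc, ← mul_assoc y, h1, smul_mul_assoc, mul_assoc _ y, h2, mul_smul_comm,
            smul_smul, smul_mul_assoc, pow_succ']
          simp only [mul_assoc]
        rw [this]
        exact S.smul_mem _ (mem _ _ _ _)
      · have : y * (c ^ i * y ^ j * (x ^ k * d ^ l)) = c ^ i * y ^ (j + 1) * (x ^ k * d ^ l) := by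
          have := hbc i 1
          rw [pow_one] at this
          rw [← mul_assoc, ← mul_assoc y, this, mul_assoc _ y, ← pow_succ']
        rw [this]
        exact mem _ _ _ _
      · have : y * (y ^ i * b ^ j * (x ^ k * d ^ l)) = y ^ (i + 1) * b ^ j * (x ^ k * d ^ l) := by
          rw [pow_succ']
          simp only [mul_assoc]
        rw [this]
        exact mem _ _ _ _
      · have h1 := mul_pow_of_qcomm h.dc i
        have h2 := mul_pow_of_qcomm hb' j
        have h3 : y * (c ^ i * b ^ j * (x ^ k * y ^ l)) =
            (ξ ^ i * (ξ ^ m)⁻¹ ^ j) • (c ^ i * b ^ j * (y * x ^ k * y ^ l)) := by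
          rw [← mul_assoc, ← mul_assoc y, h1, smul_mul_assoc, mul_assoc _ y, h2, mul_smul_comm,
            smul_smul, smul_mul_assoc]
          simp only [mul_assoc]
        rw [h3]
        refine S.smul_mem _ ?_
        cases k with
        | zero =>
          rw [pow_zero, mul_one, ← pow_succ']
          simpa using mem i j 0 (l + 1)
        | succ k =>
          obtain ⟨α, β, hαβ⟩ := exists_mul_pow_eq hcx h.xb
            (by rw [← neg_sub, h.xd, neg_sub] : y * x - x * y = c ^ m - b) k
          have h4 : c ^ i * b ^ j * (y * x ^ (k + 1) * y ^ l) =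
              c ^ i * b ^ j * (x ^ (k + 1) * y ^ (l + 1)) +
              (α • (c ^ (i + m) * b ^ j * (x ^ k * y ^ l)) +
                β • (c ^ i * b ^ (j + 1) * (x ^ k * y ^ l))) := by
            rw [hαβ, add_mul, mul_add, pow_succ' y, ← mul_assoc _ y]
            congr 1
            rw [add_mul, add_mul, mul_add, smul_mul_assoc, smul_mul_assoc, smul_mul_assoc,
              smul_mul_assoc, mul_smul_comm, mul_smul_comm, pow_add, pow_succ b, mul_assoc (c ^ i),
              mul_assoc (c ^ i), mul_assoc (c ^ i), ← hbc m j]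
            simp only [mul_assoc]
          rw [h4]
          exact S.add_mem (mem _ _ _ _) (S.add_mem (S.smul_mem _ (mem _ _ _ _))
            (S.smul_mem _ (mem _ _ _ _)))
  have all : ∀ y : R, ∀ s ∈ S, y * s ∈ S := by
    intro y
    have hy : y ∈ Algebra.adjoin K {x, b, c, d} := hgen ▸ Algebra.mem_top
    induction hy using Algebra.adjoin_induction with
    | mem y hy => exact stable y hy
    | algebraMap r =>
      intro s hs
      rw [← Algebra.smul_def]
      exact S.smul_mem _ hs
    | add u v _ _ hu hv =>
      intro s hs
      rw [add_mul]
      exact S.add_mem (hu s hs) (hv s hs)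
    | mul u v _ _ hu hv =>
      intro s hs
      rw [mul_assoc]
      exact hu _ (hv s hs)
  have top : S = ⊤ := by
    rw [eq_top_iff]
    intro y _
    simpa using all y _ (mem 0 0 0 0)
  rw [Module.finite_def, ← top]
  exact Submodule.fg_span (Set.finite_range _)

/-- Replacing `a` by `x = a + κ (c^m - q b) d^(n-1)` simplifies the relations of `H_{mn}(ξ)`. -/
theorem doubleRel_of_relations {m n : ℕ} {ξ : K} (hm : 1 < m) (hn : 1 < n)
    (hξ : IsPrimitiveRoot ξ (m * n)) (κ : K) {a b c d : R}
    (aPow : a ^ n = b ^ n - 1) (bPow : b ^ (m * n) = 1) (cPow : c ^ (m * n) = 1)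
    (dPow : d ^ n = 0) (ab : a * b = ξ ^ m • (b * a)) (dc : d * c = ξ • (c * d))
    (bc : b * c = c * b) (bd : b * d = ξ ^ m • (d * b)) (ad : a * d - d * a = b - c ^ m)
    (ac : a * c = ξ⁻¹ • (c * a) + ((ξ⁻¹ - ξ ^ (n - 1)) * κ) •
      ((c ^ (m + 1) - ξ ^ m • (b * c)) * d ^ (n - 1))) :
    DoubleRel m n ξ (a + κ • ((c ^ m - ξ ^ m • b) * d ^ (n - 1))) b c d := by
  have hmn : 0 < m * n := by positivity
  have hξ0 : ξ ≠ 0 := hξ.ne_zero hmn.ne'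
  have hq : (ξ ^ m) ^ n = 1 := by rw [← pow_mul, hξ.pow_eq_one]
  have hq0 : ξ ^ m ≠ 0 := pow_ne_zero _ hξ0
  have hξn : ξ ^ n ≠ 1 := hξ.pow_ne_one_of_pos_of_lt (by omega) (by nlinarith)
  have hb' : d * b = (ξ ^ m)⁻¹ • (b * d) := qcomm_symm hq0 bd
  have hcb : Commute c b := bc.symm
  have hd1b : d ^ (n - 1) * b = ξ ^ m • (b * d ^ (n - 1)) := by
    rw [pow_mul_of_qcomm hb' (n - 1)]
    congr 1
    rw [inv_pow]
    exact inv_eq_of_mul_eq_one_right (by rw [← pow_succ, Nat.sub_add_cancel hn.le, hq])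
  have hd1c := pow_mul_of_qcomm dc (n - 1)
  have hdcm : d * c ^ m = ξ ^ m • (c ^ m * d) := mul_pow_of_qcomm dc m
  set y : R := c ^ m - ξ ^ m • b with hy
  set e : R := d ^ (n - 1) with he
  have hyb : y * b = b * y := by
    rw [hy, sub_mul, mul_sub, smul_mul_assoc, mul_smul_comm, (hcb.pow_left m).eq]
  have hyc : y * c = c * y := by
    rw [hy, sub_mul, mul_sub, smul_mul_assoc, mul_smul_comm, bc, ← pow_succ, ← pow_succ']
  have hde : d * e = 0 := by rw [he, ← pow_succ', Nat.sub_add_cancel hn.le, dPow]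
  have hed : e * d = 0 := by rw [he, ← pow_succ, Nat.sub_add_cancel hn.le, dPow]
  have hdye : d * (y * e) = 0 := by
    rw [hy, sub_mul, mul_sub, smul_mul_assoc, mul_smul_comm, ← mul_assoc, ← mul_assoc, hdcm, hb',
      smul_mul_assoc, smul_mul_assoc, mul_assoc, mul_assoc, hde]
    simp
  have xb : (a + κ • (y * e)) * b = ξ ^ m • (b * (a + κ • (y * e))) := by
    rw [add_mul, mul_add, ab, smul_add, smul_mul_assoc, mul_smul_comm, mul_assoc, hd1b,
      mul_smul_comm, ← mul_assoc, hyb, mul_assoc, smul_comm]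
  have hDc : κ • (y * e) * c = (ξ⁻¹ * ξ ^ n) • (c * κ • (y * e)) := by
    have : ξ⁻¹ * ξ ^ n = ξ ^ (n - 1) := by
      obtain ⟨k, rfl⟩ : ∃ k, n = k + 1 := ⟨n - 1, by omega⟩
      rw [pow_succ']; field_simp; simp
    rw [this, smul_mul_assoc, mul_smul_comm, mul_assoc, hd1c, mul_smul_comm, ← mul_assoc, hyc,
      mul_assoc, smul_comm]
  have xc : (a + κ • (y * e)) * c = ξ⁻¹ • (c * (a + κ • (y * e))) := by
    have h1 : c * y = c ^ (m + 1) - ξ ^ m • (b * c) := by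
      rw [hy, mul_sub, ← pow_succ', mul_smul_comm, bc]
    have h2 : κ • (y * e) * c = (ξ ^ (n - 1) * κ) • (c * y * e) := by
      rw [smul_mul_assoc, mul_assoc, hd1c, mul_smul_comm, ← mul_assoc, hyc, smul_smul, mul_comm κ]
    rw [add_mul, h2, ac, ← h1, mul_add, smul_add, mul_smul_comm, smul_smul, sub_mul, sub_smul,
      mul_assoc c]
    abel
  have xd : (a + κ • (y * e)) * d - d * (a + κ • (y * e)) = b - c ^ m := by
    rw [add_mul, mul_add, mul_smul_comm, hdye, smul_mul_assoc, mul_assoc, hed, ← ad]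
    simp
  refine ⟨xb, xc, dc, bc, bd, xd, ?_, dPow, bPow, cPow⟩
  set x : R := a + κ • (y * e) with hx
  have hxcm : x * c ^ m = (ξ⁻¹) ^ m • (c ^ m * x) := mul_pow_of_qcomm xc m
  refine pow_eq_zero_of_sub_pow (ξ := ξ) (D := κ • (y * e)) (c := c) (f := b ^ n - 1) hξn hξ0
    ?_ ?_ xc hDc ?_ ?_
  · exact IsUnit.of_pow_eq_one cPow hmn.ne'
  · intro j hj
    have hz : e * x ^ j * e = 0 :=
      pow_mul_pow_mul_pow_eq_zero hb' hdcm xb hxcm xd dPow j _ _ (by omega)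
    have h1 := mul_pow_mul_pow_qcomm xb hb' (n - 1) j (n - 1)
    have h2 := mul_pow_mul_pow_qcomm hxcm hdcm (n - 1) j (n - 1)
    rw [← he, hz, mul_zero, smul_zero] at h1 h2
    have h3 : e * x ^ j * (y * e) = 0 := by
      rw [hy, sub_mul, mul_sub, h2, smul_mul_assoc, mul_smul_comm, h1]; simp
    rw [smul_mul_assoc, smul_mul_assoc, mul_smul_comm, mul_assoc y, mul_assoc y, h3]
    simp
  · rw [hx, add_sub_cancel_right, aPow]
  · rw [sub_mul, mul_sub, one_mul, mul_one, (hcb.pow_right n).eq]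

end Generators

/-- The projection from the free algebra onto `H_{mn}(ξ)`. -/
def mkH : FreeAlgebra 𝕜 (Fin 4) →ₐ[𝕜] H 𝕜 m n ξ := RingQuot.mkAlgHom 𝕜 (HRel 𝕜 m n ξ)

theorem mkH_rel {u v : FreeAlgebra 𝕜 (Fin 4)} (h : HRel 𝕜 m n ξ u v) :
    mkH 𝕜 m n ξ u = mkH 𝕜 m n ξ v :=
  RingQuot.mkAlgHom_rel 𝕜 h

theorem mkH_fgen (k : Fin 4) : mkH 𝕜 m n ξ (fgen 𝕜 k) = gen 𝕜 m n ξ k := rfl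

theorem adjoin_gen : Algebra.adjoin 𝕜 (Set.range (gen 𝕜 m n ξ)) = ⊤ := by
  have h : Set.range (gen 𝕜 m n ξ) =
      RingQuot.mkAlgHom 𝕜 (HRel 𝕜 m n ξ) '' Set.range (FreeAlgebra.ι 𝕜 : Fin 4 → _) := by
    rw [← Set.range_comp]; rfl
  have h2 := AlgHom.map_adjoin (RingQuot.mkAlgHom 𝕜 (HRel 𝕜 m n ξ))
    (Set.range (FreeAlgebra.ι 𝕜 : Fin 4 → _))
  rw [FreeAlgebra.adjoin_range_ι, Algebra.map_top,
    (AlgHom.range_eq_top _).mpr (RingQuot.mkAlgHom_surjective 𝕜 (HRel 𝕜 m n ξ)), ← h] at h2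
  exact h2.symm

/-- The element `a + (c^m - q b) d^(n-1) / (n-1)!_q` of `H_{mn}(ξ)`. -/
def xgen : H 𝕜 m n ξ :=
  ha + (qFact 𝕜 (ξ ^ m) (n - 1))⁻¹ • ((hc ^ m - ξ ^ m • hb) * hd ^ (n - 1))

variable {m n ξ}

theorem doubleRel_H (hm : 1 < m) (hn : 1 < n) (hξ : IsPrimitiveRoot ξ (m * n)) :
    DoubleRel m n ξ (xgen 𝕜 m n ξ) hb hc hd := by
  refine doubleRel_of_relations hm hn hξ _ ?_ ?_ ?_ ?_ ?_ ?_ ?_ ?_ ?_ ?_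
  · simpa [mkH_fgen] using mkH_rel 𝕜 m n ξ (HRel.aPow)
  · simpa [mkH_fgen] using mkH_rel 𝕜 m n ξ (HRel.bPow)
  · simpa [mkH_fgen] using mkH_rel 𝕜 m n ξ (HRel.cPow)
  · simpa [mkH_fgen] using mkH_rel 𝕜 m n ξ (HRel.dPow)
  · simpa [mkH_fgen] using mkH_rel 𝕜 m n ξ (HRel.ab)
  · simpa [mkH_fgen] using mkH_rel 𝕜 m n ξ (HRel.dc)
  · simpa [mkH_fgen] using mkH_rel 𝕜 m n ξ (HRel.bc)
  · simpa [mkH_fgen] using mkH_rel 𝕜 m n ξ (HRel.bd)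
  · simpa [mkH_fgen] using mkH_rel 𝕜 m n ξ (HRel.ad)
  · simpa [mkH_fgen, div_eq_mul_inv] using mkH_rel 𝕜 m n ξ (HRel.ac)

theorem adjoin_xgen : Algebra.adjoin 𝕜 {xgen 𝕜 m n ξ, hb, hc, hd} = ⊤ := by
  rw [← top_le_iff, ← adjoin_gen, Algebra.adjoin_le_iff]
  rintro _ ⟨k, rfl⟩
  set S := Algebra.adjoin 𝕜 {xgen 𝕜 m n ξ, hb, hc, hd} with hS
  have hx : xgen 𝕜 m n ξ ∈ S := Algebra.subset_adjoin (by simp)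
  have hb' : hb ∈ S := Algebra.subset_adjoin (by simp)
  have hc' : hc ∈ S := Algebra.subset_adjoin (by simp)
  have hd' : hd ∈ S := Algebra.subset_adjoin (by simp)
  have ha' : ha ∈ S := by
    have h : ha = xgen 𝕜 m n ξ -
        (qFact 𝕜 (ξ ^ m) (n - 1))⁻¹ • ((hc ^ m - ξ ^ m • hb) * hd ^ (n - 1)) := by
      rw [xgen, add_sub_cancel_right]
    rw [h]
    exact S.sub_mem hx (S.smul_mem (S.mul_mem (S.sub_mem (S.pow_mem hc' _) (S.smul_mem hb' _))
      (S.pow_mem hd' _)) _)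
  fin_cases k <;> assumption

theorem isArtinianRing_H (hm : 1 < m) (hn : 1 < n) (hξ : IsPrimitiveRoot ξ (m * n)) :
    IsArtinianRing (H 𝕜 m n ξ) := by
  have : Module.Finite 𝕜 (H 𝕜 m n ξ) := (doubleRel_H 𝕜 hm hn hξ).finite
    (hξ.ne_zero (by positivity)) (by positivity) (adjoin_xgen 𝕜)
  exact IsArtinianRing.of_finite 𝕜 _

theorem isSemisimpleModule_of_radM_eq_bot (hm : 1 < m) (hn : 1 < n)
    (hξ : IsPrimitiveRoot ξ (m * n)) (M : Type) [AddCommGroup M] [Module (H 𝕜 m n ξ) M]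
    (h : radM 𝕜 m n ξ M = ⊥) : IsSemisimpleModule (H 𝕜 m n ξ) M := by
  have := isArtinianRing_H 𝕜 hm hn hξ
  have ht : Module.IsTorsionBySet (H 𝕜 m n ξ) M (Ring.jacobson (H 𝕜 m n ξ)) := by
    intro w r
    have hr : (r : H 𝕜 m n ξ) • w ∈ radM 𝕜 m n ξ M :=
      Submodule.subset_span ⟨r, by rw [jrad, Ideal.jacobson_bot]; exact r.2, w, rfl⟩
    rw [h, Submodule.mem_bot] at hr
    exact hr
  let _ := ht.module
  exact (ht.semilinearMap.isSemisimpleModule_iff_of_bijective Function.bijective_id).2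
    inferInstance

section Chain

variable {K V : Type*} [Field K] [AddCommGroup V] [Module K V]

/-- A `ℤ`-indexed family of weight spaces with raising and lowering operators `X` and `D`, such
that `D * X` and `X * D` act on weight vectors as a scalar plus the nilpotent operator `E`. -/
structure Chain (n : ℕ) (X D E : Module.End K V) (W : ℤ → Submodule K V) (g : ℤ → K) :
    Prop where
  X_mem : ∀ {t : ℤ} {w : V}, w ∈ W t → X w ∈ W (t + 1)
  D_mem : ∀ {t : ℤ} {w : V}, w ∈ W t → D w ∈ W (t - 1)
  E_mem : ∀ {t : ℤ} {w : V}, w ∈ W t → E w ∈ W t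
  DX : ∀ {t : ℤ} {w : V}, w ∈ W t → D (X w) = E w + g t • w
  XD : ∀ {t : ℤ} {w : V}, w ∈ W t → X (D w) = E w + g (t - 1) • w
  commX : Commute E X
  commD : Commute E D
  nilE : IsNilpotent E
  X_pow : X ^ n = 0
  D_pow : D ^ n = 0
  periodic : ∀ s t : ℤ, (n : ℤ) ∣ s - t → g s = g t
  roots : ∀ r s t : ℤ, g r = 0 → g s = 0 → g t = 0 →
    (n : ℤ) ∣ s - r ∨ (n : ℤ) ∣ t - r ∨ (n : ℤ) ∣ t - s

namespace Chain

variable {n : ℕ} {X D E : Module.End K V} {W : ℤ → Submodule K V} {g : ℤ → K}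

theorem symm (h : Chain n X D E W g) :
    Chain n D X E (fun t => W (-t)) (fun t => g (-t - 1)) where
  X_mem {t w} hw := by
    have := h.D_mem hw
    rwa [show -t - 1 = -(t + 1) by ring] at this
  D_mem {t w} hw := by
    have := h.X_mem hw
    rwa [show -t + 1 = -(t - 1) by ring] at this
  E_mem hw := h.E_mem hw
  DX hw := h.XD hw
  XD {t w} hw := by rw [h.DX hw, show -(t - 1) - 1 = -t by ring]
  commX := h.commD
  commD := h.commX
  nilE := h.nilE
  X_pow := h.D_pow
  D_pow := h.X_pow
  periodic s t hst := h.periodic _ _ (by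
    rw [show -s - 1 - (-t - 1) = -(s - t) by ring, dvd_neg]; exact hst)
  roots r s t hr hs ht := by
    have := h.roots _ _ _ hr hs ht
    rwa [show -s - 1 - (-r - 1) = -(s - r) by ring, show -t - 1 - (-r - 1) = -(t - r) by ring,
      show -t - 1 - (-s - 1) = -(t - s) by ring, dvd_neg, dvd_neg, dvd_neg] at this

theorem X_pow_mem (h : Chain n X D E W g) {t : ℤ} {w : V} (hw : w ∈ W t) (k : ℕ) :
    (X ^ k) w ∈ W (t + k) := by
  induction k with
  | zero => simpa using hw
  | succ k ih =>
    rw [pow_succ', Module.End.mul_apply]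
    have := h.X_mem ih
    rwa [show t + (k : ℤ) + 1 = t + ((k + 1 : ℕ) : ℤ) by push_cast; ring] at this

theorem D_pow_mem (h : Chain n X D E W g) {t : ℤ} {w : V} (hw : w ∈ W t) (k : ℕ) :
    (D ^ k) w ∈ W (t - k) := by
  have := h.symm.X_pow_mem (t := -t) (w := w) (by simpa using hw) k
  simpa [neg_add_eq_sub] using this

theorem E_X_pow (h : Chain n X D E W g) (k : ℕ) (w : V) : E ((X ^ k) w) = (X ^ k) (E w) :=
  LinearMap.congr_fun (h.commX.pow_right k).eq w

theorem E_D_pow (h : Chain n X D E W g) (k : ℕ) (w : V) : E ((D ^ k) w) = (D ^ k) (E w) :=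
  LinearMap.congr_fun (h.commD.pow_right k).eq w

theorem X_pow_eq_zero (h : Chain n X D E W g) {k : ℕ} (hk : n ≤ k) (w : V) : (X ^ k) w = 0 := by
  rw [pow_eq_zero_of_le hk h.X_pow, LinearMap.zero_apply]

theorem D_pow_eq_zero (h : Chain n X D E W g) {k : ℕ} (hk : n ≤ k) (w : V) : (D ^ k) w = 0 :=
  h.symm.X_pow_eq_zero hk w

theorem eq_zero_of_X (h : Chain n X D E W g) {t : ℤ} {w : V} (hw : w ∈ W t) (hg : g t ≠ 0)
    (hX : X w = 0) : w = 0 := by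
  have h1 : E w = (-g t) • w := by
    have := h.DX hw
    rw [hX, map_zero] at this
    rw [neg_smul]
    exact eq_neg_of_add_eq_zero_left this.symm
  have h2 : ∀ k : ℕ, (E ^ k) w = (-g t) ^ k • w := by
    intro k
    induction k with
    | zero => simp
    | succ k ih => rw [pow_succ', Module.End.mul_apply, ih, map_smul, h1, smul_smul, pow_succ]
  obtain ⟨N, hN⟩ := h.nilE
  have h3 := h2 N
  rw [hN, LinearMap.zero_apply, eq_comm, smul_eq_zero] at h3
  exact h3.resolve_left (pow_ne_zero _ (neg_ne_zero.mpr hg))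

theorem eq_zero_of_X_pow (h : Chain n X D E W g) (k : ℕ) {t : ℤ} {w : V} (hw : w ∈ W t)
    (hg : ∀ s : ℕ, s < k → g (t + s) ≠ 0) (hX : (X ^ k) w = 0) : w = 0 := by
  induction k with
  | zero => simpa using hX
  | succ k ih =>
    refine ih (fun s hs => hg s (by omega)) ?_
    rw [pow_succ', Module.End.mul_apply] at hX
    exact h.eq_zero_of_X (h.X_pow_mem hw k) (hg k (by omega)) hX

theorem D_pow_X_pow (h : Chain n X D E W g) {t : ℤ} {w : V} (hw : w ∈ W t) (j r : ℕ)
    (hE : E ((D ^ j) w) = 0) :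
    (D ^ (j + r)) ((X ^ r) w) = (∏ s ∈ Finset.range r, g (t + s)) • (D ^ j) w := by
  induction r with
  | zero => simp
  | succ r ih =>
    rw [← add_assoc, pow_succ D, pow_succ' X, Module.End.mul_apply, Module.End.mul_apply,
      h.DX (h.X_pow_mem hw r), map_add, map_smul, ← h.E_D_pow, ih, map_smul, hE, smul_zero,
      zero_add, smul_smul, Finset.prod_range_succ, mul_comm (g _)]

theorem exists_root (h : Chain n X D E W g) {t : ℤ} {w : V} (hw : w ∈ W t) (hw0 : w ≠ 0) :
    ∃ k : ℕ, k < n ∧ g (t + k) = 0 := by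
  by_contra! hne
  exact hw0 (h.eq_zero_of_X_pow n hw hne (h.X_pow_eq_zero le_rfl w))

theorem exists_second_root (h : Chain n X D E W g) (hn : 0 < n) {t : ℤ} {w : V} (hw : w ∈ W t)
    (hE : E w ≠ 0) (hg : g t = 0) : ∃ p : ℕ, 0 < p ∧ p < n ∧ g (t + p) = 0 := by
  by_contra! hne
  have h1 : X w = 0 := by
    refine h.eq_zero_of_X_pow (n - 1) (h.X_mem hw) (fun s hs => ?_) ?_
    · have := hne (s + 1) (by omega) (by omega)
      rwa [show t + 1 + (s : ℤ) = t + ((s + 1 : ℕ) : ℤ) by push_cast; ring]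
    · rw [← Module.End.mul_apply, ← pow_succ, h.X_pow_eq_zero (by omega)]
  have h2 := h.DX hw
  rw [h1, hg, zero_smul, add_zero, map_zero] at h2
  exact hE h2.symm

theorem ne_zero_of_roots (h : Chain n X D E W g) {t : ℤ} {p s : ℕ} (ht : g t = 0)
    (hp : g (t + p) = 0) (hp0 : 0 < p) (hpn : p < n) (hs0 : 0 < s) (hsn : s < n) (hsp : s ≠ p) :
    g (t + s) ≠ 0 := by
  intro hs
  rcases h.roots _ _ _ ht hp hs with h1 | h1 | h1
  · rw [add_sub_cancel_left, Int.natCast_dvd_natCast] at h1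
    exact absurd (Nat.le_of_dvd hp0 h1) (by omega)
  · rw [add_sub_cancel_left, Int.natCast_dvd_natCast] at h1
    exact absurd (Nat.le_of_dvd hs0 h1) (by omega)
  · rw [add_sub_add_left_eq_sub] at h1
    have := Int.eq_zero_of_abs_lt_dvd h1 (by rw [abs_lt]; omega)
    omega

theorem X_pow_eq_zero_of_roots (h : Chain n X D E W g) {t : ℤ} {w : V} {p : ℕ} (hw : w ∈ W t)
    (ht : g t = 0) (hp : g (t + p) = 0) (hp0 : 0 < p) (hpn : p < n) :
    (X ^ (p + 1)) w = 0 ∧ E (X w) = 0 := by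
  have h1 : (X ^ (p + 1)) w = 0 := by
    refine h.eq_zero_of_X_pow (n - (p + 1)) (h.X_pow_mem hw (p + 1)) (fun s hs => ?_) ?_
    · have := h.ne_zero_of_roots (s := p + 1 + s) ht hp hp0 hpn (by omega) (by omega) (by omega)
      rwa [add_assoc, ← Nat.cast_add]
    · rw [← Module.End.mul_apply, ← pow_add]
      exact h.X_pow_eq_zero (by omega) w
  refine ⟨h1, h.eq_zero_of_X_pow (p - 1) (h.E_mem (h.X_mem hw)) (fun s hs => ?_) ?_⟩
  · have := h.ne_zero_of_roots (s := s + 1) ht hp hp0 hpn (by omega) (by omega) (by omega)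
    rwa [show t + 1 + (s : ℤ) = t + ((s + 1 : ℕ) : ℤ) by push_cast; ring]
  · rw [← h.E_X_pow, ← Module.End.mul_apply (X ^ (p - 1)), ← pow_succ, Nat.sub_add_cancel hp0]
    have h2 := h.DX (h.X_pow_mem hw p)
    rw [← Module.End.mul_apply X, ← pow_succ', h1, hp, map_zero, zero_smul, add_zero] at h2
    exact h2.symm

theorem D_pow_eq_zero_of_roots (h : Chain n X D E W g) {t : ℤ} {w : V} {p : ℕ} (hw : w ∈ W t)
    (ht : g (t - 1) = 0) (hp : g (t - 1 - p) = 0) (hp0 : 0 < p) (hpn : p < n) :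
    (D ^ (p + 1)) w = 0 ∧ E (D w) = 0 :=
  h.symm.X_pow_eq_zero_of_roots (t := -t) (by simpa using hw) (by simpa using ht)
    (by rwa [show -(-t + (p : ℤ)) - 1 = t - 1 - p by ring]) hp0 hpn

/-- A weight vector `u` is terminal if no nonzero vector obtained from `u` by iterating one of
the operators `X`, `D` is killed by the same number of applications of the other. -/
def Terminal (X D : Module.End K V) (u : V) : Prop :=
  (∀ k : ℕ, (D ^ k) ((X ^ k) u) = 0 → (X ^ k) u = 0) ∧
    ∀ k : ℕ, (X ^ k) ((D ^ k) u) = 0 → (D ^ k) u = 0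

theorem terminal_X_pow (h : Chain n X D E W g) (hE : E = 0) {t : ℤ} {w : V} (hw : w ∈ W t)
    {k : ℕ} (hk : (D ^ k) ((X ^ k) w) = 0) : Terminal X D ((X ^ k) w) := by
  have key : ∀ {t : ℤ} {w : V} (_ : w ∈ W t) (r : ℕ),
      (D ^ r) ((X ^ r) w) = (∏ s ∈ Finset.range r, g (t + s)) • w := by
    intro t w hw r
    simpa using h.D_pow_X_pow hw 0 r (by simp [hE])
  refine ⟨fun k' hk' => ?_, fun k' hk' => ?_⟩
  · rw [key (h.X_pow_mem hw k), smul_eq_zero] at hk'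
    rcases hk' with hk' | hk'
    swap
    · rw [hk', map_zero]
    rw [key hw, smul_eq_zero] at hk
    rcases hk with hk | hk
    swap
    · rw [hk, map_zero, map_zero]
    rw [Finset.prod_eq_zero_iff] at hk hk'
    obtain ⟨s₁, hs₁, h₁⟩ := hk
    obtain ⟨s₂, hs₂, h₂⟩ := hk'
    rw [Finset.mem_range] at hs₁ hs₂
    rw [← Module.End.mul_apply, ← pow_add]
    by_cases hle : n ≤ k' + k
    · exact h.X_pow_eq_zero hle w
    refine h.eq_zero_of_X_pow (n - (k' + k)) (h.X_pow_mem hw (k' + k)) (fun s hs hg => ?_) ?_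
    · have hne := h.ne_zero_of_roots (t := t + s₁) (p := k + s₂ - s₁) (s := k' + k + s - s₁) h₁
        (by rw [Nat.cast_sub (by omega)]; rw [← h₂]; congr 1; push_cast; ring)
        (by omega) (by omega) (by omega) (by omega) (by omega)
      apply hne
      rw [Nat.cast_sub (by omega), ← hg]
      congr 1
      push_cast
      ring
    · rw [← Module.End.mul_apply, ← pow_add]
      exact h.X_pow_eq_zero (by omega) w
  · by_cases hle : k ≤ k'
    · rw [← Nat.sub_add_cancel hle, pow_add, Module.End.mul_apply, hk, map_zero]
    · obtain ⟨j, rfl⟩ : ∃ j, k = k' + j := ⟨k - k', by omega⟩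
      rw [pow_add, Module.End.mul_apply, key (h.X_pow_mem hw j)] at hk' ⊢
      rw [map_smul, smul_eq_zero] at hk'
      rcases hk' with hk' | hk'
      · rw [hk', zero_smul]
      · rw [← key (h.X_pow_mem hw j), hk', map_zero]

theorem terminal_D_pow (h : Chain n X D E W g) (hE : E = 0) {t : ℤ} {w : V} (hw : w ∈ W t)
    {k : ℕ} (hk : (X ^ k) ((D ^ k) w) = 0) : Terminal X D ((D ^ k) w) :=
  (h.symm.terminal_X_pow hE (t := -t) (by simpa using hw) hk).symm

end Chain

theorem linearIndependent_and_isCompl {ι : Type*} [Fintype ι] (f : ι → V)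
    (ψ : ι → V →ₗ[K] K)
    (h : ∀ a : ι → K, (∀ j, ψ j (∑ i, a i • f i) = 0) → a = 0) :
    LinearIndependent K f ∧
      IsCompl (Submodule.span K (Set.range f)) (⨅ j, LinearMap.ker (ψ j)) := by
  refine ⟨?_, ?_, ?_⟩
  · rw [Fintype.linearIndependent_iff]
    intro a ha' i
    rw [h a (fun j => by rw [ha', map_zero]), Pi.zero_apply]
  · rw [Submodule.disjoint_def]
    intro w hw hw'
    obtain ⟨a, rfl⟩ := (Submodule.mem_span_range_iff_exists_fun K).mp hw
    rw [h a fun j => (Submodule.mem_iInf _).mp hw' j]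
    simp
  · rw [codisjoint_iff, eq_top_iff]
    intro w _
    let T : (ι → K) →ₗ[K] (ι → K) := LinearMap.pi ψ ∘ₗ Fintype.linearCombination K f
    have hT : ∀ a j, T a j = ψ j (∑ i, a i • f i) := fun a j => by
      simp [T, Fintype.linearCombination_apply]
    have inj : Function.Injective T := by
      rw [injective_iff_map_eq_zero]
      intro a h_a
      exact h a fun j => by rw [← hT, h_a, Pi.zero_apply]
    obtain ⟨a, h_a⟩ := LinearMap.injective_iff_surjective.mp inj (LinearMap.pi ψ w)
    refine Submodule.mem_sup.mpr ⟨∑ i, a i • f i,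
      (Submodule.mem_span_range_iff_exists_fun K).mpr ⟨a, rfl⟩, w - ∑ i, a i • f i, ?_, by abel⟩
    rw [Submodule.mem_iInf]
    intro j
    rw [LinearMap.mem_ker, map_sub, ← hT, h_a, LinearMap.pi_apply, sub_self]

end Chain

section DoubleRoot

variable {K V : Type*} [Field K] [AddCommGroup V] [Module K V]

/-- `A` vanishes on all weight spaces whose weight is not congruent to `S` modulo `n`. -/
def ConcentratedAt (n : ℕ) (W : ℤ → Submodule K V) (A : V →ₗ[K] K) (S : ℤ) : Prop :=
  ∀ t : ℤ, ¬ (n : ℤ) ∣ t - S → ∀ w ∈ W t, A w = 0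

theorem not_dvd_of_lt {n : ℕ} {z : ℤ} (h0 : z ≠ 0) (h1 : z < n) (h2 : -n < z) :
    ¬ (n : ℤ) ∣ z := fun h => h0 (Int.eq_zero_of_abs_lt_dvd h (abs_lt.mpr ⟨h2, h1⟩))

/-- `T` and `T - l` are incongruent roots of `g`. -/
structure DoubleRoot (n : ℕ) (g : ℤ → K) (T : ℤ) (l : ℕ) : Prop where
  pos : 0 < l
  lt : l < n
  root : g T = 0
  root' : g (T - l) = 0

/-- The functionals cutting out a complement of the submodule generated by `v` and `u`. -/
def complFunctional (n l : ℕ) (X D : Module.End K V) (φ : V →ₗ[K] K) :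
    Fin n ⊕ Fin n → V →ₗ[K] K :=
  Sum.elim (fun s => φ ∘ₗ X ^ (s : ℕ)) (fun s => (φ ∘ₗ D ^ (n - l)) ∘ₗ X ^ (s : ℕ))

namespace Chain

variable {n l : ℕ} {X D E : Module.End K V} {W : ℤ → Submodule K V} {g : ℤ → K} {T : ℤ}

theorem X_pow_D_pow (h : Chain n X D E W g) {t : ℤ} {w : V} (hw : w ∈ W t) (r : ℕ)
    (hE : E w = 0) :
    (X ^ r) ((D ^ r) w) = (∏ s ∈ Finset.range r, g (t - 1 - s)) • w := by
  have := h.symm.D_pow_X_pow (t := -t) (w := w) (by simpa using hw) 0 r (by simpa using hE)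
  rw [zero_add, pow_zero, Module.End.one_apply] at this
  rw [this]
  congr 1
  refine Finset.prod_congr rfl fun s _ => ?_
  congr 1
  ring

theorem concentratedAt_comp_X_D (h : Chain n X D E W g) {A : V →ₗ[K] K} {S : ℤ}
    (hA : ConcentratedAt n W A S) (hW : ⨆ t, W t = ⊤) (s : ℕ) (w : V) :
    A ((X ^ (s + 1)) (D w)) = A (E ((X ^ s) w)) + g (S - s - 1) * A ((X ^ s) w) := by
  have hw : w ∈ ⨆ t, W t := hW ▸ Submodule.mem_top
  induction hw using Submodule.iSup_induction' with
  | zero => simp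
  | add x y _ _ hx hy => simp only [map_add, hx, hy]; ring
  | mem t w hw =>
    rw [pow_succ, Module.End.mul_apply, h.XD hw, map_add, ← h.E_X_pow, map_smul, map_add, map_smul,
      smul_eq_mul]
    congr 1
    by_cases hd' : (n : ℤ) ∣ t + s - S
    · rw [h.periodic (t - 1) (S - s - 1) (by ring_nf at hd' ⊢; exact hd')]
    · rw [hA _ hd' _ (h.X_pow_mem hw s), mul_zero, mul_zero]

theorem ne_zero_of_doubleRoot (h : Chain n X D E W g) (hr : DoubleRoot n g T l) {s : ℤ}
    (h0 : ¬ (n : ℤ) ∣ s - T) (hl : ¬ (n : ℤ) ∣ s - (T - l)) : g s ≠ 0 := by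
  intro hs
  rcases h.roots _ _ _ hr.root' hr.root hs with h1 | h1 | h1
  · have := hr.pos
    have := hr.lt
    exact not_dvd_of_lt (by omega) (by omega) (by omega) h1
  · exact hl h1
  · exact h0 h1

theorem X_of_doubleRoot (h : Chain n X D E W g) (hr : DoubleRoot n g T l) {t : ℤ} {w : V}
    (hw : w ∈ W t) (ht : (n : ℤ) ∣ t - T) : (X ^ (n - l + 1)) w = 0 ∧ E (X w) = 0 := by
  have := hr.pos
  have := hr.lt
  refine h.X_pow_eq_zero_of_roots hw ?_ ?_ (by omega) (by omega)
  · rw [h.periodic _ _ ht, hr.root]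
  · rw [h.periodic _ (T - l), hr.root']
    rw [Nat.cast_sub (by omega)]
    have : t + ((n : ℤ) - l) - (T - l) = t - T + n := by ring
    rw [this]
    exact dvd_add ht dvd_rfl

theorem D_of_doubleRoot (h : Chain n X D E W g) (hr : DoubleRoot n g T l) {t : ℤ} {w : V}
    (hw : w ∈ W t) (ht : (n : ℤ) ∣ t - 1 - T) : E (D w) = 0 := by
  refine (h.D_pow_eq_zero_of_roots hw ?_ (p := l) ?_ hr.pos hr.lt).2
  · rw [h.periodic _ _ ht, hr.root]
  · rw [h.periodic _ (T - l), hr.root']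
    rwa [show t - 1 - l - (T - l) = t - 1 - T by ring]

theorem D_of_doubleRoot' (h : Chain n X D E W g) (hr : DoubleRoot n g T l) {t : ℤ} {w : V}
    (hw : w ∈ W t) (ht : (n : ℤ) ∣ t - 1 - (T - l)) :
    (D ^ (n - l + 1)) w = 0 ∧ E (D w) = 0 := by
  have := hr.pos
  have := hr.lt
  refine h.D_pow_eq_zero_of_roots hw ?_ ?_ (by omega) (by omega)
  · rw [h.periodic _ _ ht, hr.root']
  · rw [h.periodic _ T, hr.root]
    rw [Nat.cast_sub (by omega)]
    have : t - 1 - ((n : ℤ) - l) - T = t - 1 - (T - l) - n := by ring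
    rw [this]
    exact dvd_sub ht dvd_rfl

/-- The scalar by which `D ^ (n-l-1) * X ^ (n-l-1)` acts in weight `T + 1`. -/
def returnScalar (n l : ℕ) (g : ℤ → K) (T : ℤ) : K :=
  ∏ s ∈ Finset.range (n - l - 1), g (T + 1 + s)

theorem returnScalar_ne_zero (h : Chain n X D E W g) (hr : DoubleRoot n g T l) :
    returnScalar n l g T ≠ 0 := by
  refine Finset.prod_ne_zero_iff.mpr fun s hs => ?_
  rw [Finset.mem_range] at hs
  refine h.ne_zero_of_doubleRoot hr (not_dvd_of_lt (by omega) (by omega) (by omega)) ?_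
  rw [← dvd_sub_self_right]
  exact not_dvd_of_lt (by omega) (by omega) (by omega)

theorem returnScalar_eq (h : Chain n X D E W g) {t : ℤ} (ht : (n : ℤ) ∣ t - 1 - T) :
    ∏ s ∈ Finset.range (n - l - 1), g (t + s) = returnScalar n l g T := by
  refine Finset.prod_congr rfl fun s _ => h.periodic _ _ ?_
  rwa [show t + (s : ℤ) - (T + 1 + s) = t - 1 - T by ring]

theorem exists_lower (h : Chain n X D E W g) (hr : DoubleRoot n g T l) {v : V} (hv : v ∈ W T) :
    ∃ u ∈ W (T + (n - l)), E u = 0 ∧ X u = 0 ∧ (D ^ (n - l - 1)) u = X v ∧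
      (D ^ (n - l)) u = E v := by
  have hpos := hr.pos
  have hlt := hr.lt
  have hG := h.returnScalar_ne_zero hr
  obtain ⟨h1, h2⟩ := h.X_of_doubleRoot hr hv (by simp)
  obtain ⟨k, hk⟩ : ∃ k, n - l = k + 1 := ⟨n - l - 1, by omega⟩
  have h3 : (D ^ k) ((X ^ (n - l)) v) = returnScalar n l g T • X v := by
    have := h.D_pow_X_pow (h.X_mem hv) 0 k (by simpa using h2)
    rw [zero_add, pow_zero, Module.End.one_apply] at this
    rw [hk, pow_succ, Module.End.mul_apply, this, returnScalar, hk, Nat.add_sub_cancel]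
  have h4 : (D ^ (n - l - 1)) ((returnScalar n l g T)⁻¹ • (X ^ (n - l)) v) = X v := by
    rw [map_smul, hk, Nat.add_sub_cancel, ← hk, h3, smul_smul, inv_mul_cancel₀ hG, one_smul]
  refine ⟨(returnScalar n l g T)⁻¹ • (X ^ (n - l)) v, ?_, ?_, ?_, h4, ?_⟩
  · have := h.X_pow_mem hv (n - l)
    rw [Nat.cast_sub hlt.le] at this
    exact Submodule.smul_mem _ _ this
  · rw [map_smul, hk, pow_succ, Module.End.mul_apply, h.E_X_pow, h2, map_zero, smul_zero]
  · rw [map_smul, ← Module.End.mul_apply, ← pow_succ', h1, smul_zero]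
  · rw [show n - l = n - l - 1 + 1 by omega, pow_succ', Module.End.mul_apply,
      ← show n - l = n - l - 1 + 1 by omega, h4, h.DX hv, hr.root, zero_smul, add_zero]

section Functional

variable {φ : V →ₗ[K] K}

theorem functional_E (h : Chain n X D E W g) (hr : DoubleRoot n g T l) (hW : ⨆ t, W t = ⊤)
    (hφ : ConcentratedAt n W φ T) (w : V) :
    returnScalar n l g T * φ (E w) = φ ((D ^ (n - l)) ((X ^ (n - l)) w)) := by
  have hlt := hr.lt
  have hw : w ∈ ⨆ t, W t := hW ▸ Submodule.mem_top
  induction hw using Submodule.iSup_induction' with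
  | zero => simp
  | add x y _ _ hx hy => simp only [map_add, mul_add, hx, hy]
  | mem t w hw =>
    by_cases ht : (n : ℤ) ∣ t - T
    · obtain ⟨k, hk⟩ : ∃ k, n - l = k + 1 := ⟨n - l - 1, by omega⟩
      have h2 := (h.X_of_doubleRoot hr hw ht).2
      have h3 := h.D_pow_X_pow (h.X_mem hw) 0 (n - l - 1) (by simpa using h2)
      rw [h.returnScalar_eq (by rwa [add_sub_cancel_right]), zero_add, pow_zero,
        Module.End.one_apply, hk, Nat.add_sub_cancel] at h3
      rw [hk, pow_succ X, pow_succ' D, Module.End.mul_apply, Module.End.mul_apply, h3, map_smul,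
        h.DX hw, h.periodic _ _ ht, hr.root, zero_smul, add_zero, map_smul, smul_eq_mul]
    · have := h.D_pow_mem (h.X_pow_mem hw (n - l)) (n - l)
      rw [add_sub_cancel_right] at this
      rw [hφ _ ht _ this, hφ _ ht _ (h.E_mem hw), mul_zero]

theorem functional_D (h : Chain n X D E W g) (hr : DoubleRoot n g T l) (hW : ⨆ t, W t = ⊤)
    (hφ : ConcentratedAt n W φ T) (w : V) :
    returnScalar n l g T * φ (D w) = φ ((D ^ (n - l)) ((X ^ (n - l - 1)) w)) := by
  have hlt := hr.lt
  have hw : w ∈ ⨆ t, W t := hW ▸ Submodule.mem_top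
  induction hw using Submodule.iSup_induction' with
  | zero => simp
  | add x y _ _ hx hy => simp only [map_add, mul_add, hx, hy]
  | mem t w hw =>
    by_cases ht : (n : ℤ) ∣ t - 1 - T
    · have h2 := h.D_of_doubleRoot hr hw ht
      have h3 := h.D_pow_X_pow hw 1 (n - l - 1) (by simpa using h2)
      rw [h.returnScalar_eq ht, pow_one, show 1 + (n - l - 1) = n - l by omega] at h3
      rw [h3, map_smul, smul_eq_mul]
    · have := h.D_pow_mem (h.X_pow_mem hw (n - l - 1)) (n - l)
      rw [hφ _ ht _ (h.D_mem hw), hφ _ _ _ this, mul_zero]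
      rwa [show t + ((n - l - 1 : ℕ) : ℤ) - ((n - l : ℕ) : ℤ) = t - 1 by omega]

theorem functional_D_pow_E (h : Chain n X D E W g) (hr : DoubleRoot n g T l) (hW : ⨆ t, W t = ⊤)
    (hφ : ConcentratedAt n W φ T) (w : V) : φ ((D ^ (n - l)) (E w)) = 0 := by
  have hlt := hr.lt
  have hw : w ∈ ⨆ t, W t := hW ▸ Submodule.mem_top
  induction hw using Submodule.iSup_induction' with
  | zero => simp
  | add x y _ _ hx hy => simp only [map_add, hx, hy, add_zero]
  | mem t w hw =>
    by_cases ht : (n : ℤ) ∣ t - (n - l : ℕ) - T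
    · rw [← h.E_D_pow, show n - l = n - l - 1 + 1 by omega, pow_succ', Module.End.mul_apply,
        h.D_of_doubleRoot hr (h.D_pow_mem hw _), map_zero]
      rwa [show t - ((n - l - 1 : ℕ) : ℤ) - 1 - T = t - (n - l : ℕ) - T by omega]
    · exact hφ _ ht _ (h.D_pow_mem (h.E_mem hw) _)

theorem functional_D_pow (h : Chain n X D E W g) (hr : DoubleRoot n g T l) (hW : ⨆ t, W t = ⊤)
    (hφ : ConcentratedAt n W φ T) (w : V) : φ ((D ^ (n - l + 1)) w) = 0 := by
  have hlt := hr.lt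
  have hw : w ∈ ⨆ t, W t := hW ▸ Submodule.mem_top
  induction hw using Submodule.iSup_induction' with
  | zero => simp
  | add x y _ _ hx hy => simp only [map_add, hx, hy, add_zero]
  | mem t w hw =>
    by_cases ht : (n : ℤ) ∣ t - (n - l + 1 : ℕ) - T
    · rw [(h.D_of_doubleRoot' hr hw ?_).1, map_zero]
      rw [show t - 1 - (T - l) = t - (n - l + 1 : ℕ) - T + n by omega]
      exact dvd_add ht dvd_rfl
    · exact hφ _ ht _ (h.D_pow_mem hw _)

theorem concentratedAt_D_pow (h : Chain n X D E W g) (hφ : ConcentratedAt n W φ T) (k : ℕ) :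
    ConcentratedAt n W (φ ∘ₗ D ^ k) (T + k) := by
  intro t ht w hw
  refine hφ (t - k) ?_ _ (h.D_pow_mem hw k)
  rwa [sub_sub, add_comm (k : ℤ)]

theorem mem_ker_iff {w : V} : w ∈ (⨅ j, LinearMap.ker (complFunctional n l X D φ j)) ↔
    ∀ s : ℕ, s < n → φ ((X ^ s) w) = 0 ∧ φ ((D ^ (n - l)) ((X ^ s) w)) = 0 := by
  rw [Submodule.mem_iInf]
  refine ⟨fun hw s hs => ⟨hw (Sum.inl ⟨s, hs⟩), hw (Sum.inr ⟨s, hs⟩)⟩, fun hw j => ?_⟩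
  rcases j with s | s
  · exact (hw s s.2).1
  · exact (hw s s.2).2

theorem X_mem_ker (h : Chain n X D E W g) {w : V}
    (hw : w ∈ ⨅ j, LinearMap.ker (complFunctional n l X D φ j)) :
    X w ∈ ⨅ j, LinearMap.ker (complFunctional n l X D φ j) := by
  rw [mem_ker_iff] at hw ⊢
  intro s hs
  rw [← Module.End.mul_apply, ← pow_succ]
  by_cases hs' : s + 1 < n
  · exact hw _ hs'
  · rw [h.X_pow_eq_zero (by omega)]
    simp

theorem D_mem_ker (h : Chain n X D E W g) (hr : DoubleRoot n g T l) (hW : ⨆ t, W t = ⊤)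
    (hφ : ConcentratedAt n W φ T) {w : V}
    (hw : w ∈ ⨅ j, LinearMap.ker (complFunctional n l X D φ j)) :
    D w ∈ ⨅ j, LinearMap.ker (complFunctional n l X D φ j) := by
  rw [mem_ker_iff] at hw ⊢
  have hlt := hr.lt
  have hpos := hr.pos
  have hG := h.returnScalar_ne_zero hr
  have hw' : ∀ s : ℕ, φ ((D ^ (n - l)) ((X ^ s) w)) = 0 := by
    intro s
    by_cases hs : s < n
    · exact (hw s hs).2
    · rw [h.X_pow_eq_zero (by omega)]
      simp
  rintro (_ | s) hs
  · refine ⟨?_, ?_⟩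
    · have := h.functional_D hr hW hφ w
      rw [hw', mul_eq_zero] at this
      exact this.resolve_left hG
    · have := h.functional_D_pow hr hW hφ w
      rwa [pow_succ, Module.End.mul_apply] at this
  · refine ⟨?_, ?_⟩
    · have h2 := h.functional_E hr hW hφ ((X ^ s) w)
      rw [← Module.End.mul_apply (X ^ _), ← pow_add, hw', mul_eq_zero] at h2
      rw [h.concentratedAt_comp_X_D hφ hW, (hw s (by omega)).1, h2.resolve_left hG, mul_zero,
        add_zero]
    · have h2 := h.concentratedAt_comp_X_D (h.concentratedAt_D_pow hφ (n - l)) hW s w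
      simp only [LinearMap.comp_apply] at h2
      rw [h2, (hw s (by omega)).2, h.functional_D_pow_E hr hW hφ, mul_zero, add_zero]

end Functional

end Chain

end DoubleRoot

section Splitting

variable {K V : Type*} [Field K] [AddCommGroup V] [Module K V]

theorem coeff_eq_zero_of_functional {ι : Type*} [Fintype ι] {f : ι → V} {a : ι → K}
    (B : V →ₗ[K] K) (i : ι) (h0 : B (∑ j, a j • f j) = 0) (hi : B (f i) ≠ 0)
    (h : ∀ j, j ≠ i → a j = 0 ∨ B (f j) = 0) : a i = 0 := by
  rw [map_sum, Finset.sum_eq_single i] at h0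
  · rw [map_smul, smul_eq_mul, mul_eq_zero] at h0
    exact h0.resolve_right hi
  · intro j _ hj
    rcases h j hj with h1 | h1 <;> simp [h1]
  · simp

namespace Chain

variable {n l : ℕ} {X D E : Module.End K V} {W : ℤ → Submodule K V} {g : ℤ → K} {T : ℤ}

theorem functional_X_D_eq_zero (h : Chain n X D E W g) {A : V →ₗ[K] K} {S : ℤ}
    (hA : ConcentratedAt n W A S) {t : ℤ} {y : V} (hy : y ∈ W t) (s s' : ℕ)
    (hd' : ¬ (n : ℤ) ∣ t - s' + s - S) : A ((X ^ s) ((D ^ s') y)) = 0 :=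
  hA _ hd' _ (h.X_pow_mem (h.D_pow_mem hy s') s)

theorem exists_X_pow_D_pow_E (h : Chain n X D E W g) (hr : DoubleRoot n g T l) {v : V}
    (hv : v ∈ W T) {s : ℕ} (hs : s < l) :
    ∃ κ : K, κ ≠ 0 ∧ (X ^ s) ((D ^ s) (E v)) = κ • E v := by
  have hlt := hr.lt
  have h1 : E (E v) = 0 := by
    have h2 := h.DX hv
    rw [hr.root, zero_smul, add_zero] at h2
    have h3 := h.E_D_pow 1 (X v)
    rw [pow_one, h2, (h.X_of_doubleRoot hr hv (by simp)).2, map_zero] at h3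
    exact h3
  refine ⟨_, ?_, h.X_pow_D_pow (h.E_mem hv) s h1⟩
  refine Finset.prod_ne_zero_iff.mpr fun r hr' => ?_
  rw [Finset.mem_range] at hr'
  exact h.ne_zero_of_doubleRoot hr (not_dvd_of_lt (by omega) (by omega) (by omega))
    (not_dvd_of_lt (by omega) (by omega) (by omega))

theorem exists_X_pow_D_pow (h : Chain n X D E W g) (hr : DoubleRoot n g T l) {v : V}
    (hv : v ∈ W T) {s : ℕ} (hs : l ≤ s) (hsn : s < n) :
    ∃ κ : K, κ ≠ 0 ∧ (X ^ s) ((D ^ s) v) = κ • E v := by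
  have hpos := hr.pos
  obtain ⟨k, rfl⟩ : ∃ k, l = k + 1 := ⟨l - 1, by omega⟩
  obtain ⟨κ, hκ, h1⟩ := h.exists_X_pow_D_pow_E hr hv (Nat.lt_succ_self k)
  have h2 : E ((D ^ (k + 1)) v) = 0 := by
    rw [pow_succ', Module.End.mul_apply]
    refine (h.D_of_doubleRoot' hr (h.D_pow_mem hv k) ?_).2
    rw [show T - (k : ℤ) - 1 - (T - ((k + 1 : ℕ) : ℤ)) = 0 by push_cast; ring]
    exact dvd_zero _
  have h3 : (X ^ (k + 1)) ((D ^ (k + 1)) v) = κ • E v := by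
    rw [pow_succ, pow_succ', Module.End.mul_apply, Module.End.mul_apply, h.XD (h.D_pow_mem hv k),
      show T - (k : ℤ) - 1 = T - ((k + 1 : ℕ) : ℤ) by push_cast; ring, hr.root', zero_smul,
      add_zero, h.E_D_pow, h1]
  obtain ⟨j, rfl⟩ : ∃ j, s = k + 1 + j := ⟨s - (k + 1), by omega⟩
  refine ⟨(∏ r ∈ Finset.range j, g (T - ((k + 1 : ℕ) : ℤ) - 1 - r)) * κ, mul_ne_zero ?_ hκ, ?_⟩
  swap
  · rw [pow_add X, add_comm (k + 1) j, pow_add D, Module.End.mul_apply, Module.End.mul_apply,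
      h.X_pow_D_pow (h.D_pow_mem hv _) _ h2, map_smul, h3, smul_smul]
  · refine Finset.prod_ne_zero_iff.mpr fun r hr' => ?_
    rw [Finset.mem_range] at hr'
    exact h.ne_zero_of_doubleRoot hr (not_dvd_of_lt (by omega) (by omega) (by omega))
      (not_dvd_of_lt (by omega) (by omega) (by omega))

theorem exists_X_pow_D_pow_lower (h : Chain n X D E W g) (hr : DoubleRoot n g T l) {u : V}
    (hu : u ∈ W (T + (n - l))) (hE : E u = 0) {s : ℕ} (hs : s < n - l) :
    ∃ κ : K, κ ≠ 0 ∧ (X ^ s) ((D ^ s) u) = κ • u := by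
  have hpos := hr.pos
  refine ⟨_, ?_, h.X_pow_D_pow hu s hE⟩
  refine Finset.prod_ne_zero_iff.mpr fun r hr' => ?_
  rw [Finset.mem_range] at hr'
  refine h.ne_zero_of_doubleRoot hr (not_dvd_of_lt (by omega) (by omega) (by omega)) ?_
  rw [← dvd_sub_self_right]
  exact not_dvd_of_lt (by omega) (by omega) (by omega)

theorem linearIndependent_and_isCompl_of_doubleRoot (h : Chain n X D E W g)
    (hr : DoubleRoot n g T l) (hW : ⨆ t, W t = ⊤) {φ : V →ₗ[K] K} (hφ : ConcentratedAt n W φ T)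
    {v u : V} (hv : v ∈ W T) (hφv : φ (E v) ≠ 0) (hu : u ∈ W (T + (n - l))) (hEu : E u = 0)
    (hXu : X u = 0) (hDu : (D ^ (n - l)) u = E v) :
    LinearIndependent K (Sum.elim (fun s : Fin n => (D ^ (s : ℕ)) v) fun s : Fin n => (D ^ (s : ℕ)) u) ∧
      IsCompl (Submodule.span K (Set.range
        (Sum.elim (fun s : Fin n => (D ^ (s : ℕ)) v) fun s : Fin n => (D ^ (s : ℕ)) u)))
        (⨅ j, LinearMap.ker (complFunctional n l X D φ j)) := by
  have hlt := hr.lt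
  have hpos := hr.pos
  refine linearIndependent_and_isCompl _ (complFunctional n l X D φ) fun a hker => ?_
  set p := ∑ i : Fin n ⊕ Fin n, a i •
    Sum.elim (fun s : Fin n => (D ^ (s : ℕ)) v) (fun s : Fin n => (D ^ (s : ℕ)) u) i with hp
  have key := fun B i => coeff_eq_zero_of_functional (a := a) (f := Sum.elim
    (fun s : Fin n => (D ^ (s : ℕ)) v) fun s : Fin n => (D ^ (s : ℕ)) u) B i
  have hker' := mem_ker_iff.mp ((Submodule.mem_iInf _).mpr hker)
  have hG := h.returnScalar_ne_zero hr
  have nd : ∀ {s s' : Fin n} {z : ℤ}, z = (s : ℤ) - s' → s ≠ s' → ¬ (n : ℤ) ∣ z := by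
    rintro s s' z rfl hne
    have := Fin.val_ne_of_ne hne
    exact not_dvd_of_lt (by omega) (by omega) (by omega)
  have inl_lt : ∀ s : Fin n, (s : ℕ) < l → a (Sum.inl s) = 0 := by
    intro s hs
    refine key ((φ ∘ₗ E) ∘ₗ X ^ (s : ℕ)) _ ?_ ?_ ?_
    · have h1 := h.functional_E hr hW hφ ((X ^ (s : ℕ)) p)
      rw [← Module.End.mul_apply (X ^ _), ← pow_add, (hker' _ (by omega)).2, mul_eq_zero] at h1
      exact h1.resolve_left hG
    · obtain ⟨κ, hκ, h1⟩ := h.exists_X_pow_D_pow_E hr hv hs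
      rw [Sum.elim_inl, LinearMap.comp_apply, LinearMap.comp_apply, h.E_X_pow, h.E_D_pow, h1,
        map_smul]
      exact smul_ne_zero hκ hφv
    · rintro (s' | s') hne <;> right
      · rw [Sum.elim_inl, LinearMap.comp_apply]
        have hφE : ConcentratedAt n W (φ ∘ₗ E) T := fun t ht w hw => hφ t ht _ (h.E_mem hw)
        refine h.functional_X_D_eq_zero hφE hv _ _ (nd (s := s) (s' := s') (by ring) ?_)
        rintro rfl
        exact hne rfl
      · rw [Sum.elim_inr, LinearMap.comp_apply, LinearMap.comp_apply, h.E_X_pow, h.E_D_pow, hEu]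
        simp
  have inl_ge : ∀ s : Fin n, l ≤ (s : ℕ) → a (Sum.inl s) = 0 := by
    intro s hs
    refine key (φ ∘ₗ X ^ (s : ℕ)) _ (hker' _ s.2).1 ?_ ?_
    · obtain ⟨κ, hκ, h1⟩ := h.exists_X_pow_D_pow hr hv hs s.2
      rw [Sum.elim_inl, LinearMap.comp_apply, h1, map_smul]
      exact smul_ne_zero hκ hφv
    · rintro (s' | s') hne <;> right
      · rw [Sum.elim_inl, LinearMap.comp_apply]
        refine h.functional_X_D_eq_zero hφ hv _ _ (nd (s := s) (s' := s') (by ring) ?_)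
        rintro rfl
        exact hne rfl
      · rw [Sum.elim_inr, LinearMap.comp_apply]
        by_cases hs' : (s : ℕ) = l + s'
        · rw [hs', pow_add, Module.End.mul_apply, h.X_pow_D_pow hu _ hEu, map_smul,
            show l = l - 1 + 1 by omega, pow_succ, Module.End.mul_apply, hXu]
          simp
        · refine h.functional_X_D_eq_zero hφ hu _ _ ?_
          rw [← dvd_sub_self_right]
          exact not_dvd_of_lt (by omega) (by omega) (by omega)
  have inl_eq : ∀ s : Fin n, a (Sum.inl s) = 0 := fun s =>
    (lt_or_ge (s : ℕ) l).elim (inl_lt s) (inl_ge s)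
  have inr_eq : ∀ s : Fin n, a (Sum.inr s) = 0 := by
    intro s
    by_cases hs : (s : ℕ) < n - l
    · refine key ((φ ∘ₗ D ^ (n - l)) ∘ₗ X ^ (s : ℕ)) _ (hker' _ s.2).2 ?_ ?_
      · obtain ⟨κ, hκ, h1⟩ := h.exists_X_pow_D_pow_lower hr hu hEu hs
        rw [Sum.elim_inr, LinearMap.comp_apply, h1, map_smul, LinearMap.comp_apply, hDu]
        exact smul_ne_zero hκ hφv
      · rintro (s' | s') hne
        · exact Or.inl (inl_eq s')
        · right
          rw [Sum.elim_inr, LinearMap.comp_apply]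
          refine h.functional_X_D_eq_zero (h.concentratedAt_D_pow hφ (n - l)) hu _ _
            (nd (s := s) (s' := s') (by omega) ?_)
          rintro rfl
          exact hne rfl
    · obtain ⟨k, hk⟩ : ∃ k, (s : ℕ) = k + (n - l) := ⟨s - (n - l), by omega⟩
      refine key (φ ∘ₗ X ^ k) _ (hker' _ (by omega)).1 ?_ ?_
      · obtain ⟨κ, hκ, h1⟩ := h.exists_X_pow_D_pow_E hr hv (s := k) (by omega)
        rw [Sum.elim_inr, LinearMap.comp_apply, hk, pow_add, Module.End.mul_apply, hDu, h1,
          map_smul]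
        exact smul_ne_zero hκ hφv
      · rintro (s' | s') hne
        · exact Or.inl (inl_eq s')
        · right
          rw [Sum.elim_inr, LinearMap.comp_apply]
          refine h.functional_X_D_eq_zero hφ hu _ _ (nd (s := s) (s' := s') (by omega) ?_)
          rintro rfl
          exact hne rfl
  funext i
  rcases i with s | s
  · exact inl_eq s
  · exact inr_eq s

end Chain

end Splitting

section WeightSpaces

variable {K R : Type*} [Field K] [Ring R] [Algebra K R]

/-- The central element `d x + (b + q c^m) / (1 - q)`. -/
def casimir (m : ℕ) (ξ : K) (x b c d : R) : R :=
  d * x + (1 - ξ ^ m)⁻¹ • (b + ξ ^ m • c ^ m)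

theorem commute_of_adjoin_eq_top {s : Set R} (hs : Algebra.adjoin K s = ⊤) {z : R}
    (hz : ∀ y ∈ s, z * y = y * z) (r : R) : z * r = r * z := by
  have hr : r ∈ Algebra.adjoin K s := hs ▸ Algebra.mem_top
  induction hr using Algebra.adjoin_induction with
  | mem y hy => exact hz y hy
  | algebraMap k => exact (Algebra.commutes k z).symm
  | add u v _ _ hu hv => rw [mul_add, add_mul, hu, hv]
  | mul u v _ _ hu hv => rw [← mul_assoc, hu, mul_assoc, hv, mul_assoc]

namespace DoubleRel

variable {m n : ℕ} {ξ : K} {x b c d : R}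

theorem d_mul_b (h : DoubleRel m n ξ x b c d) (hξ0 : ξ ≠ 0) : d * b = (ξ ^ m)⁻¹ • (b * d) :=
  qcomm_symm (pow_ne_zero _ hξ0) h.bd

theorem d_mul_c_pow (h : DoubleRel m n ξ x b c d) : d * c ^ m = ξ ^ m • (c ^ m * d) :=
  mul_pow_of_qcomm h.dc m

theorem x_mul_c_pow (h : DoubleRel m n ξ x b c d) : x * c ^ m = (ξ ^ m)⁻¹ • (c ^ m * x) := by
  rw [mul_pow_of_qcomm h.xc m, inv_pow]

theorem casimir_comm (h : DoubleRel m n ξ x b c d) (hξ0 : ξ ≠ 0) (hq : 1 - ξ ^ m ≠ 0)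
    (hgen : Algebra.adjoin K {x, b, c, d} = ⊤) (r : R) :
    casimir m ξ x b c d * r = r * casimir m ξ x b c d := by
  refine commute_of_adjoin_eq_top hgen ?_ r
  have hq0 : ξ ^ m ≠ 0 := pow_ne_zero _ hξ0
  have hbc : Commute b c := h.bc
  have hxd : x * d = d * x + (b - c ^ m) := by rw [← h.xd]; abel
  intro y hy
  simp only [Set.mem_insert_iff, Set.mem_singleton_iff] at hy
  rcases hy with rfl | rfl | rfl | rfl
  · rw [casimir, add_mul, mul_add, smul_mul_assoc, mul_smul_comm, add_mul, mul_add, ← mul_assoc,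
      hxd, h.xb, mul_smul_comm, h.x_mul_c_pow, smul_mul_assoc, smul_smul, mul_inv_cancel₀ hq0,
      add_mul, sub_mul, add_assoc]
    congr 1
    rw [← sub_eq_zero]
    match_scalars <;> field_simp <;> ring
  · rw [casimir, add_mul, mul_add, mul_assoc, h.xb, mul_smul_comm, ← mul_assoc, h.d_mul_b hξ0,
      smul_mul_assoc, smul_smul, mul_inv_cancel₀ hq0, one_smul, mul_assoc, smul_mul_assoc,
      mul_smul_comm, add_mul, mul_add, smul_mul_assoc, mul_smul_comm, (hbc.pow_right m).eq]
  · rw [casimir, add_mul, mul_add, mul_assoc, h.xc, mul_smul_comm, ← mul_assoc, h.dc,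
      smul_mul_assoc, smul_smul, inv_mul_cancel₀ hξ0, one_smul, mul_assoc, smul_mul_assoc,
      mul_smul_comm, add_mul, mul_add, smul_mul_assoc, mul_smul_comm, h.bc, ← pow_succ, ← pow_succ']
  · rw [casimir, add_mul, mul_add, smul_mul_assoc, mul_smul_comm, add_mul, mul_add, mul_assoc,
      hxd, h.bd, mul_smul_comm, h.d_mul_c_pow, smul_mul_assoc, mul_add, mul_sub, h.d_mul_c_pow,
      add_assoc]
    congr 1
    rw [← sub_eq_zero]
    match_scalars <;> field_simp <;> ring

theorem b_mul_c_pow_comm (h : DoubleRel m n ξ x b c d) (hξ0 : ξ ≠ 0)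
    (hgen : Algebra.adjoin K {x, b, c, d} = ⊤) (r : R) : b * c ^ m * r = r * (b * c ^ m) := by
  refine commute_of_adjoin_eq_top hgen ?_ r
  have hq0 : ξ ^ m ≠ 0 := pow_ne_zero _ hξ0
  have hbc : Commute b c := h.bc
  intro y hy
  simp only [Set.mem_insert_iff, Set.mem_singleton_iff] at hy
  rcases hy with rfl | rfl | rfl | rfl
  · rw [← mul_assoc, h.xb, smul_mul_assoc, mul_assoc, mul_assoc, h.x_mul_c_pow, mul_smul_comm,
      smul_smul, mul_inv_cancel₀ hq0, one_smul]
  · rw [mul_assoc, (hbc.pow_right m).eq]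
  · rw [mul_assoc, ← pow_succ, pow_succ', ← mul_assoc, h.bc, mul_assoc]
  · rw [← mul_assoc, h.d_mul_b hξ0, smul_mul_assoc, mul_assoc, mul_assoc, h.d_mul_c_pow,
      mul_smul_comm, smul_smul, inv_mul_cancel₀ hq0, one_smul]

theorem b_mul_c_pow_pow (h : DoubleRel m n ξ x b c d) : (b * c ^ m) ^ (m * n) = 1 := by
  have hbc : Commute b c := h.bc
  rw [(hbc.pow_right m).mul_pow, h.b_pow, ← pow_mul, mul_comm m, pow_mul, h.c_pow, one_pow, one_mul]

end DoubleRel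

variable {M : Type*} [AddCommGroup M] [Module K M] [Module R M] [IsScalarTower K R M]

theorem exists_isNilpotent_sub [IsAlgClosed K] [FiniteDimensional K M] [Nontrivial M]
    (hind : ∀ N₁ N₂ : Submodule R M, IsCompl N₁ N₂ → N₁ = ⊥ ∨ N₂ = ⊥) {z : R}
    (hz : ∀ r, z * r = r * z) :
    ∃ ω : K, IsNilpotent (Algebra.lsmul K K M z - algebraMap K (Module.End K M) ω) := by
  obtain ⟨ω, hω⟩ := Module.End.exists_eigenvalue (Algebra.lsmul K K M z)
  refine ⟨ω, ?_⟩
  let f : Module.End R M :=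
    { toFun := fun w => (z - algebraMap K R ω) • w
      map_add' := smul_add _
      map_smul' := fun r w => by
        rw [RingHom.id_apply, smul_smul, smul_smul, sub_mul, mul_sub, hz, Algebra.commutes] }
  have hf : ∀ (k : ℕ) (w : M), (f ^ k) w =
      ((Algebra.lsmul K K M z - algebraMap K (Module.End K M) ω) ^ k) w := by
    intro k
    induction k with
    | zero => simp
    | succ k ih =>
      intro w
      rw [pow_succ', pow_succ', Module.End.mul_apply, Module.End.mul_apply, ih]
      simp [f, sub_smul]
  have := isNoetherian_of_tower K (inferInstance : IsNoetherian K M) (S := R)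
  have := isArtinian_of_tower K (inferInstance : IsArtinian K M) (S := R)
  obtain ⟨N, hN, hN1⟩ := (f.eventually_isCompl_ker_pow_range_pow.and
    (Filter.eventually_ge_atTop 1)).exists
  rcases hind _ _ hN with h1 | h1
  · obtain ⟨w, hw, hw0⟩ := hω.exists_hasEigenvector
    exfalso
    apply hw0
    have : w ∈ LinearMap.ker (f ^ N) := by
      rw [LinearMap.mem_ker, hf, ← Nat.sub_add_cancel hN1, pow_succ, Module.End.mul_apply]
      have : (Algebra.lsmul K K M z - algebraMap K (Module.End K M) ω) w = 0 := by
        rw [LinearMap.sub_apply, Module.End.mem_eigenspace_iff.mp hw]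
        simp
      rw [this, map_zero]
    rwa [h1, Submodule.mem_bot] at this
  · refine ⟨N, LinearMap.ext fun w => ?_⟩
    rw [← hf, LinearMap.range_eq_bot.mp h1]
    simp

theorem exists_eq_algebraMap_of_pow_eq_one [IsAlgClosed K] [FiniteDimensional K M] [Nontrivial M]
    (hind : ∀ N₁ N₂ : Submodule R M, IsCompl N₁ N₂ → N₁ = ⊥ ∨ N₂ = ⊥) {z : R}
    (hz : ∀ r, z * r = r * z) {P : ℕ} (hP : (P : K) ≠ 0) (hzP : z ^ P = 1) :
    ∃ ω : K, ω ^ P = 1 ∧ ∀ w : M, z • w = ω • w := by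
  obtain ⟨ω, hω⟩ := exists_isNilpotent_sub (K := K) hind hz
  have hss : (Algebra.lsmul K K M z).IsSemisimple := by
    refine Module.End.isSemisimple_of_squarefree_aeval_eq_zero
      (Polynomial.separable_X_pow_sub_C (1 : K) hP one_ne_zero).squarefree ?_
    rw [map_one, map_sub, map_one, map_pow, Polynomial.aeval_X, ← map_pow, hzP, map_one, sub_self]
  have h0 := Module.End.eq_zero_of_isNilpotent_isSemisimple hω
    (Module.End.isSemisimple_sub_algebraMap_iff.mpr hss)
  have h1 : ∀ w : M, z • w = ω • w := by
    intro w
    have := LinearMap.congr_fun (sub_eq_zero.mp h0) w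
    simpa using this
  refine ⟨ω, ?_, h1⟩
  obtain ⟨w, hw⟩ := exists_ne (0 : M)
  have h2 : ∀ k : ℕ, (z ^ k) • w = ω ^ k • w := by
    intro k
    induction k with
    | zero => simp
    | succ k ih => rw [pow_succ', mul_smul, ih, h1, smul_smul, pow_succ']
  have h3 := h2 P
  rw [hzP, one_smul] at h3
  have h4 : (ω ^ P - 1) • w = 0 := by rw [sub_smul, one_smul, ← h3, sub_self]
  exact sub_eq_zero.mp ((smul_eq_zero.mp h4).resolve_right hw)

end WeightSpaces

section WeightProjections

variable {K R : Type*} [Field K] [Ring R] [Algebra K R]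

/-- The projection onto the `ξ ^ t`-eigenspace of an element `c` with `c ^ P = 1`. -/
def weightProj (P : ℕ) (ξ : K) (c : R) (t : ℤ) : R :=
  (P : K)⁻¹ • ∑ k ∈ Finset.range P, (ξ ^ (-t)) ^ k • c ^ k

theorem natCast_ne_zero_of_isPrimitiveRoot {P : ℕ} {ξ : K} (hξ : IsPrimitiveRoot ξ P)
    (hP : 0 < P) : (P : K) ≠ 0 := by
  have : NeZero P := ⟨hP.ne'⟩
  exact hξ.neZero'.out

theorem geom_sum_zpow_eq_zero {P : ℕ} {ξ : K} (hξ : IsPrimitiveRoot ξ P) {z : ℤ}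
    (hz : ¬ (P : ℤ) ∣ z) : ∑ k ∈ Finset.range P, (ξ ^ z) ^ k = 0 := by
  have h1 : ξ ^ z - 1 ≠ 0 := fun h0 => hz ((hξ.zpow_eq_one_iff_dvd z).mp (sub_eq_zero.mp h0))
  refine (mul_eq_zero.mp ?_).resolve_left h1
  rw [mul_geom_sum, ← zpow_natCast, ← zpow_mul, mul_comm, zpow_mul, zpow_natCast, hξ.pow_eq_one,
    one_zpow, sub_self]

theorem mul_weightProj {P : ℕ} {ξ : K} (hξ : ξ ^ P = 1) (hξ0 : ξ ≠ 0) {c : R} (h_c : c ^ P = 1)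
    (t : ℤ) : c * weightProj P ξ c t = ξ ^ t • weightProj P ξ c t := by
  have h1 : ξ ^ (-t) • (c * ∑ k ∈ Finset.range P, (ξ ^ (-t)) ^ k • c ^ k) =
      ∑ k ∈ Finset.range P, (ξ ^ (-t)) ^ k • c ^ k := by
    rw [Finset.mul_sum, Finset.smul_sum]
    have h2 : ∀ k ∈ Finset.range P, ξ ^ (-t) • (c * (ξ ^ (-t)) ^ k • c ^ k) =
        (ξ ^ (-t)) ^ (k + 1) • c ^ (k + 1) := fun k _ => by
      rw [mul_smul_comm, smul_smul, ← pow_succ', ← pow_succ']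
    rw [Finset.sum_congr rfl h2]
    have h3 := Finset.sum_range_succ' (fun k => (ξ ^ (-t)) ^ k • c ^ k) P
    rw [Finset.sum_range_succ] at h3
    have h4 : (ξ ^ (-t)) ^ P = 1 := by
      rw [← zpow_natCast, ← zpow_mul, mul_comm, zpow_mul, zpow_natCast, hξ, one_zpow]
    rw [h4, h_c, pow_zero, pow_zero] at h3
    exact (add_right_cancel h3).symm
  rw [weightProj, mul_smul_comm, smul_comm (ξ ^ t)]
  congr 1
  conv_rhs => rw [← h1]
  rw [smul_smul, ← zpow_add₀ hξ0, add_neg_cancel, zpow_zero, one_smul]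

theorem sum_weightProj {P : ℕ} {ξ : K} (hξ : IsPrimitiveRoot ξ P) (hP : 0 < P) (c : R) :
    ∑ t ∈ Finset.range P, weightProj P ξ c t = 1 := by
  have hP0 := natCast_ne_zero_of_isPrimitiveRoot hξ hP
  simp only [weightProj]
  rw [← Finset.smul_sum, Finset.sum_comm, Finset.sum_eq_single 0]
  · simp [hP0, ← Nat.cast_smul_eq_nsmul K, smul_smul]
  · intro k hk hk0
    rw [← Finset.sum_smul]
    have h1 : ∀ t ∈ Finset.range P, (ξ ^ (-(t : ℤ))) ^ k = (ξ ^ (-(k : ℤ))) ^ t := fun t _ => by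
      rw [← zpow_natCast, ← zpow_natCast, ← zpow_mul, ← zpow_mul]
      congr 1
      ring
    rw [Finset.sum_congr rfl h1, geom_sum_zpow_eq_zero hξ, zero_smul]
    rw [Finset.mem_range] at hk
    exact not_dvd_of_lt (by omega) (by omega) (by omega)
  · intro h0
    exact absurd (Finset.mem_range.mpr hP) h0

variable {M : Type*} [AddCommGroup M] [Module K M] [Module R M] [IsScalarTower K R M]

variable (M) in
/-- The `ξ ^ t`-eigenspace of `c` in `M`. -/
def weightSpace (ξ : K) (c : R) (t : ℤ) : Submodule K M :=
  Module.End.eigenspace (Algebra.lsmul K K M c) (ξ ^ t)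

theorem mem_weightSpace {ξ : K} {c : R} {t : ℤ} {w : M} :
    w ∈ weightSpace M ξ c t ↔ c • w = ξ ^ t • w := Module.End.mem_eigenspace_iff

theorem pow_smul_of_mem_weightSpace {ξ : K} {c : R} {t : ℤ} {w : M}
    (hw : w ∈ weightSpace M ξ c t) (k : ℕ) : (c ^ k) • w = (ξ ^ k) ^ t • w := by
  induction k with
  | zero => simp
  | succ k ih =>
    rw [pow_succ', mul_smul, ih, smul_comm, mem_weightSpace.mp hw, smul_smul, pow_succ, mul_zpow]

theorem weightSpace_congr {P : ℕ} {ξ : K} (hξ : IsPrimitiveRoot ξ P) (hξ0 : ξ ≠ 0) {c : R}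
    {s t : ℤ} (h : (P : ℤ) ∣ s - t) : weightSpace M ξ c s = weightSpace M ξ c t := by
  have : ξ ^ s = ξ ^ t := by
    rw [← sub_add_cancel s t, zpow_add₀ hξ0, (hξ.zpow_eq_one_iff_dvd _).mpr h, one_mul]
  rw [weightSpace, weightSpace, this]

theorem weightProj_smul_mem {P : ℕ} {ξ : K} (hξ : ξ ^ P = 1) (hξ0 : ξ ≠ 0) {c : R}
    (h_c : c ^ P = 1) (t : ℤ) (w : M) : weightProj P ξ c t • w ∈ weightSpace M ξ c t := by
  rw [mem_weightSpace, smul_smul, mul_weightProj hξ hξ0 h_c, smul_assoc]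

theorem weightProj_smul {P : ℕ} {ξ : K} {c : R} {s : ℤ} {w : M}
    (hξ0 : ξ ≠ 0) (hw : w ∈ weightSpace M ξ c s) (t : ℤ) :
    weightProj P ξ c t • w = ((P : K)⁻¹ * ∑ k ∈ Finset.range P, (ξ ^ (s - t)) ^ k) • w := by
  rw [weightProj, smul_assoc, Finset.sum_smul, ← smul_smul, Finset.sum_smul]
  congr 1
  refine Finset.sum_congr rfl fun k _ => ?_
  rw [smul_assoc, pow_smul_of_mem_weightSpace hw, smul_smul]
  congr 1
  rw [← zpow_natCast, ← zpow_natCast, ← zpow_natCast, ← zpow_mul, ← zpow_mul, ← zpow_mul,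
    ← zpow_add₀ hξ0]
  congr 1
  ring

theorem weightProj_smul_of_dvd {P : ℕ} {ξ : K} (hξ : IsPrimitiveRoot ξ P) (hP : 0 < P) {c : R}
    {s t : ℤ} {w : M} (hw : w ∈ weightSpace M ξ c s) (h : (P : ℤ) ∣ s - t) :
    weightProj P ξ c t • w = w := by
  rw [weightProj_smul (hξ.ne_zero hP.ne') hw, (hξ.zpow_eq_one_iff_dvd _).mpr h]
  simp [natCast_ne_zero_of_isPrimitiveRoot hξ hP]

theorem weightProj_smul_of_not_dvd {P : ℕ} {ξ : K} (hξ : IsPrimitiveRoot ξ P) (hP : 0 < P)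
    {c : R} {s t : ℤ} {w : M} (hw : w ∈ weightSpace M ξ c s) (h : ¬ (P : ℤ) ∣ s - t) :
    weightProj P ξ c t • w = 0 := by
  rw [weightProj_smul (hξ.ne_zero hP.ne') hw, geom_sum_zpow_eq_zero hξ h, mul_zero, zero_smul]

theorem iSup_weightSpace {P : ℕ} {ξ : K} (hξ : IsPrimitiveRoot ξ P) (hP : 0 < P) {c : R}
    (h_c : c ^ P = 1) : ⨆ t, weightSpace M ξ c t = ⊤ := by
  rw [eq_top_iff]
  intro w _
  rw [← one_smul R w, ← sum_weightProj hξ hP c, Finset.sum_smul]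
  exact Submodule.sum_mem _ fun t _ => Submodule.mem_iSup_of_mem (t : ℤ)
    (weightProj_smul_mem hξ.pow_eq_one (hξ.ne_zero hP.ne') h_c t w)

/-- The scalar part of `d x` on the weight space of weight `t`, when `b c^m` acts as `β` and the
Casimir element has eigenvalue `ω`. -/
def weightScalar (m : ℕ) (ξ ω β : K) (t : ℤ) : K :=
  ω - (β * (ξ ^ m) ^ (-t) + ξ ^ m * (ξ ^ m) ^ t) / (1 - ξ ^ m)

theorem weightScalar_eq_zero_iff {m : ℕ} {ξ ω β : K} {t : ℤ} (hξ0 : ξ ≠ 0)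
    (hq : 1 - ξ ^ m ≠ 0) : weightScalar m ξ ω β t = 0 ↔
      ω * (1 - ξ ^ m) * (ξ ^ m) ^ t = β + ξ ^ m * ((ξ ^ m) ^ t) ^ 2 := by
  have h0 : (ξ ^ m) ^ t ≠ 0 := zpow_ne_zero _ (pow_ne_zero _ hξ0)
  rw [weightScalar, zpow_neg]
  generalize (ξ ^ m) ^ t = y at h0 ⊢
  rw [sub_eq_zero, eq_div_iff hq]
  field_simp

theorem b_smul_of_mul_smul {m : ℕ} {ξ : K} {b c : R} (hξ0 : ξ ≠ 0) {β : K}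
    (hβ : ∀ w : M, (b * c ^ m) • w = β • w) {t : ℤ} {w : M} (hw : w ∈ weightSpace M ξ c t) :
    b • w = (β * (ξ ^ m) ^ (-t)) • w := by
  have h0 : (ξ ^ m) ^ t ≠ 0 := zpow_ne_zero _ (pow_ne_zero _ hξ0)
  have h1 := hβ w
  rw [mul_smul, pow_smul_of_mem_weightSpace hw, smul_comm b] at h1
  rw [mul_comm β, ← smul_smul, ← h1, smul_smul, zpow_neg, inv_mul_cancel₀ h0, one_smul]

namespace DoubleRel

variable {m n : ℕ} {ξ : K} {x b c d : R}

theorem chain (h : DoubleRel m n ξ x b c d) (hξ : IsPrimitiveRoot ξ (m * n)) (hm : 0 < m)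
    (hn : 1 < n) (hgen : Algebra.adjoin K {x, b, c, d} = ⊤) {ω β : K}
    (hβ : ∀ w : M, (b * c ^ m) • w = β • w)
    (hω : IsNilpotent (Algebra.lsmul K K M (casimir m ξ x b c d) -
      algebraMap K (Module.End K M) ω)) :
    Chain n (Algebra.lsmul K K M x) (Algebra.lsmul K K M d)
      (Algebra.lsmul K K M (casimir m ξ x b c d) - algebraMap K (Module.End K M) ω)
      (weightSpace M ξ c) (weightScalar m ξ ω β) := by
  have hmn : 0 < m * n := by positivity
  have hξ0 : ξ ≠ 0 := hξ.ne_zero hmn.ne'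
  have hq0 : ξ ^ m ≠ 0 := pow_ne_zero _ hξ0
  have hqn : IsPrimitiveRoot (ξ ^ m) n := hξ.pow hmn rfl
  have hq : 1 - ξ ^ m ≠ 0 := sub_ne_zero.mpr (hqn.ne_one hn).symm
  have dx : ∀ {t : ℤ} {w : M}, w ∈ weightSpace M ξ c t → d • x • w =
      (casimir m ξ x b c d • w - ω • w) + weightScalar m ξ ω β t • w := by
    intro t w hw
    rw [casimir, add_smul, smul_assoc, add_smul, smul_assoc, b_smul_of_mul_smul hξ0 hβ hw,
      pow_smul_of_mem_weightSpace hw, mul_smul, weightScalar]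
    generalize d • x • w = y
    module
  have x_mem : ∀ {t : ℤ} {w : M}, w ∈ weightSpace M ξ c t → x • w ∈ weightSpace M ξ c (t + 1) := by
    intro t w hw
    rw [mem_weightSpace] at hw ⊢
    have h1 : c * x = ξ • (x * c) := by rw [h.xc, smul_smul, mul_inv_cancel₀ hξ0, one_smul]
    rw [smul_smul, h1, smul_assoc, mul_smul, hw, smul_comm x, smul_smul, zpow_add₀ hξ0, zpow_one,
      mul_comm]
  have d_mem : ∀ {t : ℤ} {w : M}, w ∈ weightSpace M ξ c t → d • w ∈ weightSpace M ξ c (t - 1) := by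
    intro t w hw
    rw [mem_weightSpace] at hw ⊢
    have h1 : c * d = ξ⁻¹ • (d * c) := qcomm_symm hξ0 h.dc
    rw [smul_smul, h1, smul_assoc, mul_smul, hw, smul_comm d, smul_smul, zpow_sub₀ hξ0, zpow_one,
      div_eq_mul_inv, mul_comm]
  have commute : ∀ r : R, Commute (Algebra.lsmul K K M (casimir m ξ x b c d) -
      algebraMap K (Module.End K M) ω) (Algebra.lsmul K K M r) := by
    intro r
    refine Commute.sub_left ?_ (Algebra.commutes _ _)
    rw [Commute, SemiconjBy, ← map_mul, ← map_mul, h.casimir_comm hξ0 hq hgen]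
  refine ⟨x_mem, d_mem, ?_, ?_, ?_, commute x, commute d, hω, ?_, ?_, ?_, ?_⟩
  · intro t w hw
    have h1 := dx hw
    have h2 : d • x • w ∈ weightSpace M ξ c t := by simpa using d_mem (x_mem hw)
    have h3 : casimir m ξ x b c d • w - ω • w = d • x • w - weightScalar m ξ ω β t • w := by
      rw [h1, add_sub_cancel_right]
    simpa [h3] using Submodule.sub_mem _ h2 (Submodule.smul_mem _ _ hw)
  · intro t w hw
    simpa using dx hw
  · intro t w hw
    have h1 : x • d • w = d • x • w + (b • w - c ^ m • w) := by
      rw [smul_smul, smul_smul, ← sub_smul, ← h.xd, sub_smul]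
      abel
    have h2 : (ξ ^ m) ^ t = ξ ^ m * (ξ ^ m) ^ (t - 1) := by
      rw [← zpow_one_add₀ hq0]
      congr 1
      ring
    have h3 : (ξ ^ m) ^ (-(t - 1)) = ξ ^ m * (ξ ^ m) ^ (-t) := by
      rw [← zpow_one_add₀ hq0]
      congr 1
      ring
    have h4 : x • d • w = (casimir m ξ x b c d • w - ω • w) +
        weightScalar m ξ ω β (t - 1) • w := by
      rw [h1, dx hw, b_smul_of_mul_smul hξ0 hβ hw, pow_smul_of_mem_weightSpace hw, add_assoc, ← sub_smul,
        ← add_smul]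
      congr 2
      rw [weightScalar, weightScalar, h3, h2]
      field_simp
      ring
    simpa using h4
  · rw [← map_pow, h.x_pow, map_zero]
  · rw [← map_pow, h.d_pow, map_zero]
  · intro s t hst
    have h1 : (ξ ^ m) ^ s = (ξ ^ m) ^ t := by
      rw [← sub_add_cancel s t, zpow_add₀ hq0, (hqn.zpow_eq_one_iff_dvd _).mpr hst, one_mul]
    rw [weightScalar, weightScalar, zpow_neg, zpow_neg, h1]
  · intro r s t hr hs ht
    rw [weightScalar_eq_zero_iff hξ0 hq] at hr hs ht
    have h_dvd : ∀ {r s : ℤ}, (ξ ^ m) ^ r = (ξ ^ m) ^ s → (n : ℤ) ∣ s - r := by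
      intro r s hrs
      rw [← hqn.zpow_eq_one_iff_dvd, zpow_sub₀ hq0, hrs, div_self (zpow_ne_zero _ hq0)]
    by_contra! hne
    have n1 : (ξ ^ m) ^ r - (ξ ^ m) ^ s ≠ 0 := fun h0 => hne.1 (h_dvd (sub_eq_zero.mp h0))
    have n2 : (ξ ^ m) ^ r - (ξ ^ m) ^ t ≠ 0 := fun h0 => hne.2.1 (h_dvd (sub_eq_zero.mp h0))
    have n3 : (ξ ^ m) ^ s - (ξ ^ m) ^ t ≠ 0 := fun h0 => hne.2.2 (h_dvd (sub_eq_zero.mp h0))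
    generalize (ξ ^ m) ^ r = y₁ at *
    generalize (ξ ^ m) ^ s = y₂ at *
    generalize (ξ ^ m) ^ t = y₃ at *
    have e1 : (y₁ - y₂) * (ω * (1 - ξ ^ m) - ξ ^ m * (y₁ + y₂)) = 0 := by
      linear_combination hr - hs
    have e2 : (y₁ - y₃) * (ω * (1 - ξ ^ m) - ξ ^ m * (y₁ + y₃)) = 0 := by
      linear_combination hr - ht
    have e1' := (mul_eq_zero.mp e1).resolve_left n1
    have e2' := (mul_eq_zero.mp e2).resolve_left n2
    have e3 : ξ ^ m * (y₂ - y₃) = 0 := by linear_combination e2' - e1'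
    exact n3 ((mul_eq_zero.mp e3).resolve_left hq0)

end DoubleRel

end WeightProjections

section DoubleModule

variable {K R M : Type*} [Field K] [Ring R] [Algebra K R] [AddCommGroup M] [Module K M]
  [Module R M] [IsScalarTower K R M]

/-- The nilpotent part of the action of the Casimir element. -/
def nilCasimir (M : Type*) [AddCommGroup M] [Module K M] [Module R M] [IsScalarTower K R M]
    (m : ℕ) (ξ ω : K) (x b c d : R) : Module.End K M :=
  Algebra.lsmul K K M (casimir m ξ x b c d) - algebraMap K (Module.End K M) ω

variable (M) in
/-- `M` is a module on which `b c^m` acts as `β` and the Casimir element has `ω` as its only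
generalized eigenvalue. -/
structure DoubleModule (m n : ℕ) (ξ ω β : K) (x b c d : R) : Prop where
  rel : DoubleRel m n ξ x b c d
  one_lt_m : 1 < m
  one_lt_n : 1 < n
  prim : IsPrimitiveRoot ξ (m * n)
  adjoin : Algebra.adjoin K {x, b, c, d} = ⊤
  scalar : ∀ w : M, (b * c ^ m) • w = β • w
  nilpotent : IsNilpotent (nilCasimir M m ξ ω x b c d)

namespace DoubleModule

variable {m n : ℕ} {ξ ω β : K} {x b c d : R}

theorem mul_pos (h : DoubleModule M m n ξ ω β x b c d) : 0 < m * n :=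
  Nat.mul_pos (by have := h.one_lt_m; omega) (by have := h.one_lt_n; omega)

theorem two_mul_le (h : DoubleModule M m n ξ ω β x b c d) : 2 * n ≤ m * n :=
  Nat.mul_le_mul_right n h.one_lt_m

theorem ne_zero (h : DoubleModule M m n ξ ω β x b c d) : ξ ≠ 0 := h.prim.ne_zero h.mul_pos.ne'

theorem prim_pow (h : DoubleModule M m n ξ ω β x b c d) : IsPrimitiveRoot (ξ ^ m) n :=
  h.prim.pow h.mul_pos rfl

theorem one_sub_ne_zero (h : DoubleModule M m n ξ ω β x b c d) : 1 - ξ ^ m ≠ 0 :=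
  sub_ne_zero.mpr (h.prim_pow.ne_one h.one_lt_n).symm

theorem chain (h : DoubleModule M m n ξ ω β x b c d) :
    Chain n (Algebra.lsmul K K M x) (Algebra.lsmul K K M d) (nilCasimir M m ξ ω x b c d)
      (weightSpace M ξ c) (weightScalar m ξ ω β) :=
  h.rel.chain h.prim (by have := h.one_lt_m; omega) h.one_lt_n h.adjoin h.scalar h.nilpotent

theorem iSup_weightSpace (h : DoubleModule M m n ξ ω β x b c d) :
    ⨆ t, weightSpace M ξ c t = ⊤ :=
  Radford.iSup_weightSpace h.prim h.mul_pos h.rel.c_pow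

theorem smul_mem (h : DoubleModule M m n ξ ω β x b c d) {N : Submodule K M}
    (hx : ∀ w ∈ N, x • w ∈ N) (hc' : ∀ w ∈ N, c • w ∈ N) (hd' : ∀ w ∈ N, d • w ∈ N) (r : R) :
    ∀ w ∈ N, r • w ∈ N := by
  have hpow : ∀ k : ℕ, ∀ w ∈ N, (c ^ k) • w ∈ N := by
    intro k
    induction k with
    | zero => simp
    | succ k ih =>
      intro w hw
      rw [pow_succ', mul_smul]
      exact hc' _ (ih w hw)
  have h_b : ∀ w ∈ N, b • w ∈ N := by
    intro w hw
    have h1 : b = b * c ^ m * c ^ (m * n - m) := by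
      rw [mul_assoc, ← pow_add, Nat.add_sub_cancel' (Nat.le_mul_of_pos_right m
        (by have := h.one_lt_n; omega)), h.rel.c_pow, mul_one]
    rw [h1, mul_smul, h.scalar]
    exact N.smul_mem _ (hpow _ w hw)
  have hr : r ∈ Algebra.adjoin K {x, b, c, d} := h.adjoin ▸ Algebra.mem_top
  induction hr using Algebra.adjoin_induction with
  | mem y hy =>
    simp only [Set.mem_insert_iff, Set.mem_singleton_iff] at hy
    rcases hy with rfl | rfl | rfl | rfl
    · exact hx
    · exact h_b
    · exact hc'
    · exact hd'
  | algebraMap k =>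
    intro w hw
    rw [algebraMap_smul]
    exact N.smul_mem _ hw
  | add u v _ _ hu hv =>
    intro w hw
    rw [add_smul]
    exact N.add_mem (hu w hw) (hv w hw)
  | mul u v _ _ hu hv =>
    intro w hw
    rw [mul_smul]
    exact hu _ (hv w hw)

/-- A `K`-subspace stable under `x`, `c` and `d`, as an `R`-submodule. -/
def toSubmodule (h : DoubleModule M m n ξ ω β x b c d) (N : Submodule K M)
    (hx : ∀ w ∈ N, x • w ∈ N) (hc' : ∀ w ∈ N, c • w ∈ N) (hd' : ∀ w ∈ N, d • w ∈ N) :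
    Submodule R M :=
  { N.toAddSubmonoid with smul_mem' := fun r w hw => h.smul_mem hx hc' hd' r w hw }

theorem c_smul_mem_span {ι : Type*} {f : ι → M} (τ : ι → ℤ)
    (hf : ∀ i, f i ∈ weightSpace M ξ c (τ i)) :
    ∀ w ∈ Submodule.span K (Set.range f), c • w ∈ Submodule.span K (Set.range f) := by
  intro w hw
  induction hw using Submodule.span_induction with
  | zero => simp
  | add u v _ _ hu hv => rw [smul_add]; exact Submodule.add_mem _ hu hv
  | smul k u _ hu => rw [smul_comm]; exact Submodule.smul_mem _ _ hu
  | mem u hu =>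
    obtain ⟨i, rfl⟩ := hu
    rw [mem_weightSpace.mp (hf i)]
    exact Submodule.smul_mem _ _ (Submodule.subset_span ⟨i, rfl⟩)

theorem smul_mem_span {ι : Type*} {f : ι → M} {r : R}
    (hf : ∀ i, r • f i ∈ Submodule.span K (Set.range f)) :
    ∀ w ∈ Submodule.span K (Set.range f), r • w ∈ Submodule.span K (Set.range f) := by
  intro w hw
  induction hw using Submodule.span_induction with
  | zero => simp
  | add u v _ _ hu hv => rw [smul_add]; exact Submodule.add_mem _ hu hv
  | smul k u _ hu => rw [smul_comm]; exact Submodule.smul_mem _ _ hu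
  | mem u hu =>
    obtain ⟨i, rfl⟩ := hu
    exact hf i

theorem weightProj_smul_sum (h : DoubleModule M m n ξ ω β x b c d) {ι : Type*} [Fintype ι]
    {f : ι → M} {τ : ι → ℤ} (hf : ∀ i, f i ∈ weightSpace M ξ c (τ i))
    (hτ : ∀ i j, i ≠ j → ¬ ((m * n : ℕ) : ℤ) ∣ τ j - τ i) (a : ι → K) (i : ι) :
    weightProj (m * n) ξ c (τ i) • ∑ j, a j • f j = a i • f i := by
  rw [Finset.smul_sum, Finset.sum_eq_single i]
  · rw [smul_comm, weightProj_smul_of_dvd h.prim h.mul_pos (hf i) (by simp)]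
  · intro j _ hj
    rw [smul_comm, weightProj_smul_of_not_dvd h.prim h.mul_pos (hf j) (hτ i j hj.symm), smul_zero]
  · simp

end DoubleModule

theorem eq_zero_of_jacobson_smul {j : R} (hj : j ∈ Ring.jacobson R) {μ : K} (hμ : μ ≠ 0) {w : M}
    (h : j • w = μ • w) : w = 0 := by
  rw [← Ideal.jacobson_bot, Ideal.mem_jacobson_iff] at hj
  obtain ⟨z, hz⟩ := hj (algebraMap K R (-μ⁻¹))
  rw [Submodule.mem_bot, sub_eq_zero] at hz
  have h1 : w = (z * algebraMap K R (-μ⁻¹) * j + z) • w := by rw [hz, one_smul]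
  rw [h1, add_smul, mul_smul, mul_smul, h, algebraMap_smul, smul_smul, ← smul_add, neg_mul,
    inv_mul_cancel₀ hμ, neg_smul, one_smul, neg_add_cancel, smul_zero]

/-- The weight vectors obtained from `w` by iterating `X` and `D`. -/
def orbit (n : ℕ) (X D : Module.End K M) (w : M) : Fin n ⊕ Fin n → M :=
  Sum.elim (fun k => (X ^ (k : ℕ)) w) fun k => (D ^ ((k : ℕ) + 1)) w

namespace Chain

variable {n : ℕ} {X D E : Module.End K M} {W : ℤ → Submodule K M} {g : ℤ → K}

theorem X_pow_mem_span_orbit (h : Chain n X D E W g) (k : ℕ) (w : M) :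
    (X ^ k) w ∈ Submodule.span K (Set.range (orbit n X D w)) := by
  by_cases hk : k < n
  · exact Submodule.subset_span ⟨Sum.inl ⟨k, hk⟩, rfl⟩
  · rw [h.X_pow_eq_zero (by omega)]
    exact Submodule.zero_mem _

theorem D_pow_mem_span_orbit (h : Chain n X D E W g) (k : ℕ) (w : M) :
    (D ^ k) w ∈ Submodule.span K (Set.range (orbit n X D w)) := by
  by_cases hk : k < n
  · rcases k with _ | k
    · exact h.X_pow_mem_span_orbit 0 w
    · exact Submodule.subset_span ⟨Sum.inr ⟨k, by omega⟩, rfl⟩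
  · rw [h.D_pow_eq_zero (by omega)]
    exact Submodule.zero_mem _

theorem X_orbit_mem (h : Chain n X D E W g) (hE : E = 0) {t : ℤ} {w : M} (hw : w ∈ W t)
    (i : Fin n ⊕ Fin n) :
    X (orbit n X D w i) ∈ Submodule.span K (Set.range (orbit n X D w)) := by
  rcases i with k | k
  · have := h.X_pow_mem_span_orbit (k + 1) w
    rwa [pow_succ', Module.End.mul_apply] at this
  · have h1 := h.XD (h.D_pow_mem hw k)
    rw [hE, LinearMap.zero_apply, zero_add] at h1
    have h2 : orbit n X D w (Sum.inr k) = D ((D ^ (k : ℕ)) w) := by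
      simp only [orbit, Sum.elim_inr, pow_succ', Module.End.mul_apply]
    rw [h2, h1]
    exact Submodule.smul_mem _ _ (h.D_pow_mem_span_orbit k w)

theorem D_orbit_mem (h : Chain n X D E W g) (hE : E = 0) {t : ℤ} {w : M} (hw : w ∈ W t)
    (i : Fin n ⊕ Fin n) :
    D (orbit n X D w i) ∈ Submodule.span K (Set.range (orbit n X D w)) := by
  rcases i with ⟨k, hk⟩ | k
  · rcases k with _ | k
    · simpa [orbit] using h.D_pow_mem_span_orbit 1 w
    · have h1 := h.DX (h.X_pow_mem hw k)
      rw [hE, LinearMap.zero_apply, zero_add] at h1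
      have h2 : orbit n X D w (Sum.inl ⟨k + 1, hk⟩) = X ((X ^ k) w) := by
        simp only [orbit, Sum.elim_inl, pow_succ', Module.End.mul_apply]
      rw [h2, h1]
      exact Submodule.smul_mem _ _ (h.X_pow_mem_span_orbit k w)
  · have := h.D_pow_mem_span_orbit (k + 1 + 1) w
    rwa [pow_succ', Module.End.mul_apply] at this

end Chain

namespace DoubleModule

variable {m n : ℕ} {ξ ω β : K} {x b c d : R}

theorem exists_jacobson_smul_eq (h : DoubleModule M m n ξ ω β x b c d)
    (hE : nilCasimir M m ξ ω x b c d = 0) {t : ℤ} {w : M} (hw : w ∈ weightSpace M ξ c t) {j : R}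
    (hj : j ∈ Ring.jacobson R) :
    ∃ a : Fin n ⊕ Fin n → K,
      ∑ i, a i • orbit n (Algebra.lsmul K K M x) (Algebra.lsmul K K M d) w i = j • w ∧
      (∀ k : Fin n, a (Sum.inl k) = 0 ∨ (d ^ (k : ℕ)) • (x ^ (k : ℕ)) • w = 0) ∧
      ∀ k : Fin n, a (Sum.inr k) = 0 ∨ (x ^ ((k : ℕ) + 1)) • (d ^ ((k : ℕ) + 1)) • w = 0 := by
  have hch := h.chain
  have h2n := h.two_mul_le
  set X := Algebra.lsmul K K M x
  set D := Algebra.lsmul K K M d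
  let τ : Fin n ⊕ Fin n → ℤ := Sum.elim (fun k => t + (k : ℕ)) fun k => t - ((k : ℕ) + 1 : ℕ)
  have hτ : ∀ i, orbit n X D w i ∈ weightSpace M ξ c (τ i) := by
    rintro (k | k)
    · exact hch.X_pow_mem hw k
    · exact hch.D_pow_mem hw (k + 1)
  have hdvd : ∀ i j, i ≠ j → ¬ ((m * n : ℕ) : ℤ) ∣ τ j - τ i := by
    rintro (⟨k, hk⟩ | ⟨k, hk⟩) (⟨k', hk'⟩ | ⟨k', hk'⟩) hne <;>
      simp only [ne_eq, Sum.inl.injEq, Sum.inr.injEq, Fin.mk.injEq] at hne <;>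
      simp only [τ, Sum.elim_inl, Sum.elim_inr] <;>
      exact not_dvd_of_lt (by omega) (by omega) (by omega)
  have hmem : j • w ∈ Submodule.span K (Set.range (orbit n X D w)) := by
    refine h.smul_mem (smul_mem_span fun i => hch.X_orbit_mem hE hw i)
      (c_smul_mem_span τ hτ) (smul_mem_span fun i => hch.D_orbit_mem hE hw i) j w ?_
    simpa using hch.X_pow_mem_span_orbit 0 w
  obtain ⟨a, ha'⟩ := (Submodule.mem_span_range_iff_exists_fun K).mp hmem
  have key : ∀ i (r : R) (κ : K), r • orbit n X D w i = κ • w → a i = 0 ∨ κ • w = 0 := by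
    intro i r κ hr
    by_contra! hne
    have h1 : (r * weightProj (m * n) ξ c (τ i) * j) • w = (a i * κ) • w := by
      rw [mul_smul, ← ha', mul_smul, h.weightProj_smul_sum hτ hdvd, smul_comm, hr, smul_smul]
    refine hne.2 ?_
    rw [eq_zero_of_jacobson_smul (Ideal.mul_mem_left _ _ hj)
      (mul_ne_zero hne.1 fun h0 => hne.2 (by rw [h0, zero_smul])) h1, smul_zero]
  have hX : ∀ k : ℕ, (x ^ k) • w = (X ^ k) w := fun k => by rw [← map_pow]; rfl
  refine ⟨a, ha', fun k => ?_, fun k => ?_⟩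
  · have h1 : (d ^ (k : ℕ)) • (x ^ (k : ℕ)) • w = (∏ s ∈ Finset.range k,
        weightScalar m ξ ω β (t + s)) • w := by
      have := hch.D_pow_X_pow hw 0 k (by simp [hE])
      rw [zero_add, ← map_pow, ← map_pow, pow_zero] at this
      exact this
    rw [h1]
    refine key (Sum.inl k) (d ^ (k : ℕ)) _ ?_
    rw [← h1, hX]
    rfl
  · have h1 : (x ^ ((k : ℕ) + 1)) • (d ^ ((k : ℕ) + 1)) • w = (∏ s ∈ Finset.range ((k : ℕ) + 1),
        weightScalar m ξ ω β (t - 1 - s)) • w := by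
      have := hch.X_pow_D_pow hw ((k : ℕ) + 1) (by simp [hE])
      rw [← map_pow, ← map_pow] at this
      exact this
    rw [h1]
    refine key (Sum.inr k) (x ^ ((k : ℕ) + 1)) _ ?_
    rw [← h1, orbit, Sum.elim_inr, ← map_pow]
    rfl

theorem jacobson_smul_jacobson_smul (h : DoubleModule M m n ξ ω β x b c d)
    (hE : nilCasimir M m ξ ω x b c d = 0) {r s : R} (hr : r ∈ Ring.jacobson R)
    (hs : s ∈ Ring.jacobson R) (w : M) : r • s • w = 0 := by
  have hch := h.chain
  have terminal : ∀ {t : ℤ} {u : M}, u ∈ weightSpace M ξ c t →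
      Chain.Terminal (Algebra.lsmul K K M x) (Algebra.lsmul K K M d) u → r • u = 0 := by
    intro t u hu hT
    obtain ⟨a, h1, h2, h3⟩ := h.exists_jacobson_smul_eq hE hu hr
    rw [← h1]
    refine Finset.sum_eq_zero fun i _ => ?_
    rcases i with k | k
    · rcases h2 k with h0 | h0
      · rw [h0, zero_smul]
      · rw [orbit, Sum.elim_inl, hT.1 k, smul_zero]
        rw [← map_pow, ← map_pow]
        exact h0
    · rcases h3 k with h0 | h0
      · rw [h0, zero_smul]
      · rw [orbit, Sum.elim_inr, hT.2 (k + 1), smul_zero]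
        rw [← map_pow, ← map_pow]
        exact h0
  have hw : w ∈ ⨆ t, weightSpace M ξ c t := h.iSup_weightSpace ▸ Submodule.mem_top
  induction hw using Submodule.iSup_induction' with
  | zero => simp
  | add u v _ _ hu hv => rw [smul_add, smul_add, hu, hv, add_zero]
  | mem t w hw =>
    obtain ⟨a, h1, h2, h3⟩ := h.exists_jacobson_smul_eq hE hw hs
    rw [← h1, Finset.smul_sum]
    refine Finset.sum_eq_zero fun i _ => ?_
    rw [smul_comm]
    rcases i with k | k
    · rcases h2 k with h0 | h0
      · rw [h0, zero_smul]
      · rw [orbit, Sum.elim_inl, terminal (hch.X_pow_mem hw k)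
          (hch.terminal_X_pow hE hw ?_), smul_zero]
        rw [← map_pow, ← map_pow]
        exact h0
    · rcases h3 k with h0 | h0
      · rw [h0, zero_smul]
      · rw [orbit, Sum.elim_inr, terminal (hch.D_pow_mem hw (k + 1))
          (hch.terminal_D_pow hE hw ?_), smul_zero]
        rw [← map_pow, ← map_pow]
        exact h0

end DoubleModule

end DoubleModule

section Projective

variable {K R M : Type*} [Field K] [Ring R] [Algebra K R] [AddCommGroup M] [Module K M]
  [Module R M] [IsScalarTower K R M]

theorem weightProj_mul {P : ℕ} {ξ : K} (hξ : ξ ^ P = 1) (hξ0 : ξ ≠ 0) {c : R} (h_c : c ^ P = 1)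
    (t : ℤ) : weightProj P ξ c t * c = ξ ^ t • weightProj P ξ c t := by
  rw [← mul_weightProj hξ hξ0 h_c, weightProj, smul_mul_assoc, mul_smul_comm, Finset.sum_mul,
    Finset.mul_sum]
  congr 1
  refine Finset.sum_congr rfl fun k _ => ?_
  rw [smul_mul_assoc, mul_smul_comm, ← pow_succ, ← pow_succ']

namespace Chain

variable {n l : ℕ} {X D E : Module.End K M} {W : ℤ → Submodule K M} {g : ℤ → K} {T : ℤ}

theorem exists_weight_E_ne_zero (h : Chain n X D E W g) (hn : 0 < n) (hW : ⨆ t, W t = ⊤)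
    (hE : E ≠ 0) : ∃ (T : ℤ) (l : ℕ), DoubleRoot n g T l ∧ ∃ v ∈ W T, E v ≠ 0 := by
  obtain ⟨t, w, hw, hEw⟩ : ∃ t, ∃ w ∈ W t, E w ≠ 0 := by
    by_contra! hne
    refine hE (LinearMap.ker_eq_top.mp (top_le_iff.mp (hW ▸ iSup_le fun t w hw => ?_)))
    exact hne t w hw
  classical
  have hex := h.exists_root hw (fun h0 => hEw (by rw [h0, map_zero]))
  have hEv : E ((X ^ Nat.find hex) w) ≠ 0 := by
    intro h0
    rw [h.E_X_pow] at h0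
    exact hEw (h.eq_zero_of_X_pow _ (h.E_mem hw)
      (fun s hs hs0 => Nat.find_min hex hs ⟨hs.trans (Nat.find_spec hex).1, hs0⟩) h0)
  obtain ⟨p, hp0, hpn, hp⟩ := h.exists_second_root hn (h.X_pow_mem hw _) hEv (Nat.find_spec hex).2
  refine ⟨_, n - p, ⟨by omega, by omega, (Nat.find_spec hex).2, ?_⟩, _, h.X_pow_mem hw _, hEv⟩
  rw [h.periodic _ _ _, hp]
  exact ⟨-1, by omega⟩

theorem D_pow_smul_mem_span (h : Chain n X D E W g) (v u : M) (k : ℕ) :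
    (D ^ k) v ∈ Submodule.span K (Set.range
      (Sum.elim (fun s : Fin n => (D ^ (s : ℕ)) v) fun s : Fin n => (D ^ (s : ℕ)) u)) ∧
    (D ^ k) u ∈ Submodule.span K (Set.range
      (Sum.elim (fun s : Fin n => (D ^ (s : ℕ)) v) fun s : Fin n => (D ^ (s : ℕ)) u)) := by
  by_cases hk : k < n
  · exact ⟨Submodule.subset_span ⟨Sum.inl ⟨k, hk⟩, rfl⟩,
      Submodule.subset_span ⟨Sum.inr ⟨k, hk⟩, rfl⟩⟩
  · rw [h.D_pow_eq_zero (by omega), h.D_pow_eq_zero (by omega)]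
    exact ⟨Submodule.zero_mem _, Submodule.zero_mem _⟩

theorem X_D_pow_succ (h : Chain n X D E W g) {v u : M} (hv : v ∈ W T)
    (hDu : (D ^ (n - l)) u = E v) (s : ℕ) :
    X ((D ^ (s + 1)) v) = g (T - s - 1) • (D ^ s) v + (D ^ (n - l + s)) u := by
  rw [pow_succ', Module.End.mul_apply, h.XD (h.D_pow_mem hv s), h.E_D_pow, ← hDu,
    ← Module.End.mul_apply, ← pow_add, add_comm s, add_comm]

theorem X_D_pow_succ_of_E_eq_zero (h : Chain n X D E W g) {u : M} (hu : u ∈ W T) (hEu : E u = 0)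
    (s : ℕ) : X ((D ^ (s + 1)) u) = g (T - s - 1) • (D ^ s) u := by
  rw [pow_succ', Module.End.mul_apply, h.XD (h.D_pow_mem hu s), h.E_D_pow, hEu, map_zero, zero_add]

end Chain

namespace DoubleModule

variable {m n : ℕ} {ξ ω β : K} {x b c d : R}

theorem eq_top_of_isCompl (h : DoubleModule M m n ξ ω β x b c d)
    (hind : ∀ N₁ N₂ : Submodule R M, IsCompl N₁ N₂ → N₁ = ⊥ ∨ N₂ = ⊥) {N₁ N₂ : Submodule K M}
    (hN : IsCompl N₁ N₂) (hx₁ : ∀ w ∈ N₁, x • w ∈ N₁) (hc₁ : ∀ w ∈ N₁, c • w ∈ N₁)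
    (hd₁ : ∀ w ∈ N₁, d • w ∈ N₁) (hx₂ : ∀ w ∈ N₂, x • w ∈ N₂) (hc₂ : ∀ w ∈ N₂, c • w ∈ N₂)
    (hd₂ : ∀ w ∈ N₂, d • w ∈ N₂) {v : M} (hv : v ∈ N₁) (hv0 : v ≠ 0) : N₁ = ⊤ := by
  have h1 : IsCompl (h.toSubmodule N₁ hx₁ hc₁ hd₁) (h.toSubmodule N₂ hx₂ hc₂ hd₂) := by
    have h2 := Submodule.disjoint_def.mp hN.disjoint
    have h3 := Submodule.codisjoint_iff_exists_add_eq.mp hN.codisjoint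
    exact ⟨Submodule.disjoint_def.mpr h2, Submodule.codisjoint_iff_exists_add_eq.mpr h3⟩
  rcases hind _ _ h1 with h2 | h2
  · have h3 : v ∈ h.toSubmodule N₁ hx₁ hc₁ hd₁ := hv
    rw [h2] at h3
    exact absurd h3 hv0
  · have h3 : N₂ = ⊥ := by
      rw [eq_bot_iff]
      intro w hw
      have h4 : w ∈ h.toSubmodule N₂ hx₂ hc₂ hd₂ := hw
      rw [h2] at h4
      exact h4
    rw [h3] at hN
    exact eq_top_of_isCompl_bot hN

theorem c_smul_mem_ker (h : DoubleModule M m n ξ ω β x b c d) {l : ℕ} {T : ℤ} {φ : M →ₗ[K] K}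
    (hφ : ∀ w : M, φ (c • w) = ξ ^ T * φ w) {w : M}
    (hw : w ∈ ⨅ j, LinearMap.ker (complFunctional n l (Algebra.lsmul K K M x)
      (Algebra.lsmul K K M d) φ j)) :
    c • w ∈ ⨅ j, LinearMap.ker (complFunctional n l (Algebra.lsmul K K M x)
      (Algebra.lsmul K K M d) φ j) := by
  rw [Chain.mem_ker_iff] at hw ⊢
  intro s hs
  have h1 : ((Algebra.lsmul K K M x) ^ s) (c • w) =
      (ξ⁻¹) ^ s • c • ((Algebra.lsmul K K M x) ^ s) w := by
    rw [← map_pow]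
    change x ^ s • c • w = ξ⁻¹ ^ s • c • x ^ s • w
    rw [smul_smul, pow_mul_of_qcomm h.rel.xc, smul_assoc, mul_smul]
  have h2 : ∀ y : M, ((Algebra.lsmul K K M d) ^ (n - l)) (c • y) =
      ξ ^ (n - l) • c • ((Algebra.lsmul K K M d) ^ (n - l)) y := by
    intro y
    rw [← map_pow]
    change d ^ (n - l) • c • y = ξ ^ (n - l) • c • d ^ (n - l) • y
    rw [smul_smul, pow_mul_of_qcomm h.rel.dc, smul_assoc, mul_smul]
  rw [h1, map_smul φ (ξ⁻¹ ^ s), hφ, map_smul _ (ξ⁻¹ ^ s), h2, map_smul φ (ξ⁻¹ ^ s),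
    map_smul φ (ξ ^ (n - l)), hφ, (hw s hs).1, (hw s hs).2]
  simp

theorem exists_projective_basis (h : DoubleModule M m n ξ ω β x b c d)
    (hind : ∀ N₁ N₂ : Submodule R M, IsCompl N₁ N₂ → N₁ = ⊥ ∨ N₂ = ⊥)
    (hE : nilCasimir M m ξ ω x b c d ≠ 0) :
    ∃ (i l : ℕ) (v u : M), i < m * n ∧ DoubleRoot n (weightScalar m ξ ω β) (i + l - 1) l ∧
      v ∈ weightSpace M ξ c (i + l - 1) ∧ u ∈ weightSpace M ξ c (i + l - 1 + (n - l)) ∧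
      nilCasimir M m ξ ω x b c d u = 0 ∧ x • u = 0 ∧
      ((Algebra.lsmul K K M d) ^ (n - l - 1)) u = x • v ∧
      ((Algebra.lsmul K K M d) ^ (n - l)) u = nilCasimir M m ξ ω x b c d v ∧
      LinearIndependent K (Sum.elim (fun s : Fin n => ((Algebra.lsmul K K M d) ^ (s : ℕ)) v)
        fun s : Fin n => ((Algebra.lsmul K K M d) ^ (s : ℕ)) u) ∧
      Submodule.span K (Set.range
        (Sum.elim (fun s : Fin n => ((Algebra.lsmul K K M d) ^ (s : ℕ)) v)
        fun s : Fin n => ((Algebra.lsmul K K M d) ^ (s : ℕ)) u)) = ⊤ := by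
  have hch := h.chain
  have hmn := h.mul_pos
  have hn := h.one_lt_n
  obtain ⟨T', l, hr', v, hv', hEv⟩ := hch.exists_weight_E_ne_zero (by omega) h.iSup_weightSpace hE
  obtain ⟨i, hi, hdvd⟩ : ∃ i : ℕ, i < m * n ∧ ((m * n : ℕ) : ℤ) ∣ (i + l - 1) - T' := by
    have hpos : (0 : ℤ) < ((m * n : ℕ) : ℤ) := by exact_mod_cast hmn
    have h1 := Int.emod_nonneg (T' - l + 1) hpos.ne'
    have h2 := Int.emod_lt_of_pos (T' - l + 1) hpos
    have h3 := Int.emod_add_mul_ediv (T' - l + 1) ((m * n : ℕ) : ℤ)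
    refine ⟨((T' - l + 1) % ((m * n : ℕ) : ℤ)).toNat, by omega, ?_⟩
    rw [Int.toNat_of_nonneg h1]
    exact ⟨-((T' - l + 1) / ((m * n : ℕ) : ℤ)), by rw [mul_neg]; omega⟩
  have hdvd' : (n : ℤ) ∣ (i + l - 1) - T' :=
    dvd_trans (by push_cast; exact dvd_mul_left _ _) hdvd
  obtain ⟨T, hT⟩ : ∃ T : ℤ, T = i + l - 1 := ⟨_, rfl⟩
  rw [← hT] at hdvd hdvd'
  have hv : v ∈ weightSpace M ξ c T := by rwa [weightSpace_congr h.prim h.ne_zero hdvd]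
  have hr : DoubleRoot n (weightScalar m ξ ω β) T l :=
    ⟨hr'.pos, hr'.lt, by rw [hch.periodic _ _ hdvd', hr'.root], by
      rw [hch.periodic _ (T' - l) (by rwa [sub_sub_sub_cancel_right]), hr'.root']⟩
  obtain ⟨u, hu, hEu, hXu, hDu, hDu'⟩ := hch.exists_lower hr hv
  obtain ⟨f, hf⟩ : ∃ f : M →ₗ[K] K, f (nilCasimir M m ξ ω x b c d v) ≠ 0 := by
    by_contra! hne
    exact hEv ((Module.forall_dual_apply_eq_zero_iff K _).mp hne)
  let φ : M →ₗ[K] K := f ∘ₗ Algebra.lsmul K K M (weightProj (m * n) ξ c T)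
  have hφc : ∀ w : M, φ (c • w) = ξ ^ T * φ w := by
    intro w
    change f (weightProj (m * n) ξ c T • c • w) = ξ ^ T * f (weightProj (m * n) ξ c T • w)
    rw [smul_smul, weightProj_mul h.prim.pow_eq_one h.ne_zero h.rel.c_pow, smul_assoc, map_smul,
      smul_eq_mul]
  have hφ : ConcentratedAt n (weightSpace M ξ c) φ T := by
    intro t ht w hw
    change f (weightProj (m * n) ξ c T • w) = 0
    rw [weightProj_smul_of_not_dvd h.prim hmn hw
      (fun h0 => ht (dvd_trans (by push_cast; exact dvd_mul_left _ _) h0)), map_zero]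
  have hφv : φ (nilCasimir M m ξ ω x b c d v) ≠ 0 := by
    change f (weightProj (m * n) ξ c T • _) ≠ 0
    rwa [weightProj_smul_of_dvd h.prim hmn (hch.E_mem hv) (by simp)]
  obtain ⟨hli, hcompl⟩ := hch.linearIndependent_and_isCompl_of_doubleRoot hr h.iSup_weightSpace hφ
    hv hφv hu hEu hXu hDu'
  refine ⟨i, l, v, u, hi, hT ▸ hr, hT ▸ hv, hT ▸ hu, hEu, hXu, hDu, hDu', hli, ?_⟩
  have mem := hch.D_pow_smul_mem_span v u
  refine h.eq_top_of_isCompl hind hcompl (smul_mem_span ?_) (c_smul_mem_span (ξ := ξ)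
    (Sum.elim (fun s => T - (s : ℕ)) fun s => T + (n - l) - (s : ℕ)) ?_) (smul_mem_span ?_)
    (fun w hw => hch.X_mem_ker hw) (fun w hw => h.c_smul_mem_ker hφc hw)
    (fun w hw => hch.D_mem_ker hr h.iSup_weightSpace hφ hw) (mem 0).1
    (fun h0 => hEv (by rw [pow_zero, Module.End.one_apply] at h0; rw [h0, map_zero]))
  · rintro (⟨s, hs⟩ | ⟨s, hs⟩) <;> rcases s with _ | s
    · have := (mem (n - l - 1)).2
      rw [hDu] at this
      simpa using this
    · have := Submodule.add_mem _ (Submodule.smul_mem _ (weightScalar m ξ ω β (T - s - 1))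
        (mem s).1) (mem (n - l + s)).2
      rw [← hch.X_D_pow_succ hv hDu'] at this
      exact this
    · have h0 : x • u = 0 := hXu
      simp [h0]
    · have := Submodule.smul_mem _ (weightScalar m ξ ω β (T + (n - l) - s - 1)) (mem s).2
      rw [← hch.X_D_pow_succ_of_E_eq_zero hu hEu] at this
      exact this
  · rintro (s | s)
    · exact hch.D_pow_mem hv s
    · exact hch.D_pow_mem hu s
  · rintro (s | s)
    · have := (mem (s + 1)).1
      rw [pow_succ', Module.End.mul_apply] at this
      exact this
    · have := (mem (s + 1)).2
      rw [pow_succ', Module.End.mul_apply] at this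
      exact this

end DoubleModule

end Projective

theorem one_sub_mul_qInt (q : 𝕜) (k : ℕ) : (1 - q) * qInt 𝕜 q k = 1 - q ^ k :=
  mul_neg_geom_sum q k

theorem scalars_of_roots {ω β : 𝕜} {i : ℤ} {l : ℕ} (hξ0 : ξ ≠ 0) (hq : 1 - ξ ^ m ≠ 0)
    (hl : (ξ ^ m) ^ l ≠ 1) (h1 : weightScalar m ξ ω β (i - 1) = 0)
    (h2 : weightScalar m ξ ω β (i + l - 1) = 0) :
    β = (ξ ^ m) ^ (2 * i + l - 1) ∧ ω * (1 - ξ ^ m) = (ξ ^ m) ^ i + (ξ ^ m) ^ (i + l) := by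
  have hq0 : ξ ^ m ≠ 0 := pow_ne_zero _ hξ0
  rw [weightScalar_eq_zero_iff hξ0 hq] at h1 h2
  have e1 : (ξ ^ m) ^ (2 * i + l - 1) = ((ξ ^ m) ^ i) ^ 2 * (ξ ^ m) ^ l / ξ ^ m := by
    rw [zpow_sub_one₀ hq0, zpow_add₀ hq0, mul_comm, zpow_natCast, mul_comm 2 i, zpow_mul]
    rw [div_eq_mul_inv, mul_comm]
    norm_cast
  rw [zpow_sub_one₀ hq0, zpow_add₀ hq0, zpow_natCast] at h2
  rw [zpow_sub_one₀ hq0] at h1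
  rw [e1, zpow_add₀ hq0, zpow_natCast]
  have hy : (ξ ^ m) ^ i ≠ 0 := zpow_ne_zero _ hq0
  generalize ω * (1 - ξ ^ m) = s at *
  generalize (ξ ^ m) ^ i = y at *
  generalize (ξ ^ m) ^ l = z at *
  generalize ξ ^ m = q at *
  field_simp at h1 h2
  have hz : 1 - z ≠ 0 := sub_ne_zero.mpr (Ne.symm hl)
  have hs : s = y + y * z := by
    have h3 : y * (1 - z) * (s - (y + y * z)) = 0 := by linear_combination h1 - h2
    exact sub_eq_zero.mp ((mul_eq_zero.mp h3).resolve_left (mul_ne_zero hy hz))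
  refine ⟨?_, hs⟩
  rw [eq_div_iff hq0]
  rw [hs] at h1
  linear_combination -h1

theorem weightScalar_eq_qInt_mul {ω β : 𝕜} {i : ℤ} {l : ℕ} (hξ0 : ξ ≠ 0) (hq : 1 - ξ ^ m ≠ 0)
    (hβ : β = (ξ ^ m) ^ (2 * i + l - 1)) (hω : ω * (1 - ξ ^ m) = (ξ ^ m) ^ i + (ξ ^ m) ^ (i + l))
    (k : ℕ) :
    weightScalar m ξ ω β (i + k - 1) =
      qInt 𝕜 (ξ ^ m) k * ((ξ ^ m) ^ i - (ξ ^ m) ^ (i + (l : ℤ) - (k : ℤ))) ∧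
    weightScalar m ξ ω β (i + l + k - 1) =
      qInt 𝕜 (ξ ^ m) k * ((ξ ^ m) ^ (i + (l : ℤ)) - (ξ ^ m) ^ (i - (k : ℤ))) := by
  have hq0 : ξ ^ m ≠ 0 := pow_ne_zero _ hξ0
  have hQ : qInt 𝕜 (ξ ^ m) k = (1 - (ξ ^ m) ^ k) / (1 - ξ ^ m) := by
    rw [eq_div_iff hq, ← one_sub_mul_qInt 𝕜 (ξ ^ m) k, mul_comm]
  have hω' : ω = ((ξ ^ m) ^ i + (ξ ^ m) ^ (i + l)) / (1 - ξ ^ m) := by rw [eq_div_iff hq, hω]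
  have e : ∀ t : ℤ, weightScalar m ξ ω β t = ((ξ ^ m) ^ i + (ξ ^ m) ^ (i + l) -
      (ξ ^ m) ^ (2 * i + l - 1 - t) - (ξ ^ m) ^ (t + 1)) / (1 - ξ ^ m) := by
    intro t
    rw [weightScalar, hβ, hω', ← zpow_add₀ hq0, ← zpow_one_add₀ hq0, ← sub_div, ← sub_sub,
      add_comm 1 t, sub_eq_add_neg (2 * i + l - 1) t]
  constructor
  · rw [e, hQ, div_mul_eq_mul_div, show 2 * i + l - 1 - (i + k - 1) = i + l - k by ring,
      show i + k - 1 + 1 = i + (k : ℤ) by ring, zpow_add₀ hq0 i k, zpow_sub₀ hq0, zpow_natCast]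
    congr 1
    field_simp
    ring
  · rw [e, hQ, div_mul_eq_mul_div, show 2 * i + l - 1 - (i + l + k - 1) = i - k by ring,
      show i + l + k - 1 + 1 = i + l + (k : ℤ) by ring, zpow_add₀ hq0 (i + l) k, zpow_sub₀ hq0,
      zpow_natCast]
    congr 1
    field_simp
    ring

variable {M : Type} [AddCommGroup M] [Module 𝕜 M] [Module (H 𝕜 m n ξ) M]
  [IsScalarTower 𝕜 (H 𝕜 m n ξ) M]

theorem ha_smul_eq {ω β : 𝕜} (h : DoubleModule M m n ξ ω β (xgen 𝕜 m n ξ) hb hc hd) {t : ℤ} {w : M}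
    (hw : hd ^ (n - 1) • w ∈ weightSpace M ξ hc t) :
    ha • w = xgen 𝕜 m n ξ • w + ((ξ ^ m * (β * (ξ ^ m) ^ (-t)) - (ξ ^ m) ^ t) /
      qFact 𝕜 (ξ ^ m) (n - 1)) • hd ^ (n - 1) • w := by
  rw [xgen, add_smul, smul_assoc, mul_smul, sub_smul, smul_assoc,
    b_smul_of_mul_smul h.ne_zero h.scalar hw, pow_smul_of_mem_weightSpace hw]
  generalize hd ^ (n - 1) • w = y
  generalize ha • w = z
  module

theorem ha_smul_eq_of_eq_zero {w : M} (hw : hd ^ (n - 1) • w = 0) :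
    ha • w = xgen 𝕜 m n ξ • w := by
  rw [xgen, add_smul, smul_assoc, mul_smul, hw, smul_zero, smul_zero, add_zero]

theorem exists_doubleModule [IsAlgClosed 𝕜] [FiniteDimensional 𝕜 M] (hm : 1 < m) (hn : 1 < n)
    (hξ : IsPrimitiveRoot ξ (m * n)) (hM : Indec 𝕜 m n ξ M) :
    ∃ ω β : 𝕜, β ^ (m * n) = 1 ∧
      DoubleModule M m n ξ ω β (xgen 𝕜 m n ξ) hb hc hd := by
  have := hM.1
  have hmn : 0 < m * n := Nat.mul_pos (by omega) (by omega)
  have hξ0 : ξ ≠ 0 := hξ.ne_zero hmn.ne'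
  have hrel := doubleRel_H 𝕜 hm hn hξ
  have hgen := adjoin_xgen 𝕜 (m := m) (n := n) (ξ := ξ)
  have hq : 1 - ξ ^ m ≠ 0 := sub_ne_zero.mpr ((hξ.pow hmn rfl).ne_one hn).symm
  obtain ⟨ω, hω⟩ := exists_isNilpotent_sub (K := 𝕜) hM.2 (hrel.casimir_comm hξ0 hq hgen)
  obtain ⟨β, hβ, hβ'⟩ := exists_eq_algebraMap_of_pow_eq_one (K := 𝕜) hM.2
    (hrel.b_mul_c_pow_comm hξ0 hgen) (natCast_ne_zero_of_isPrimitiveRoot hξ hmn)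
    hrel.b_mul_c_pow_pow
  exact ⟨ω, β, hβ, hrel, hm, hn, hξ, hgen, hβ', hω⟩

theorem exists_isPrep {ω β : 𝕜} (h : DoubleModule M m n ξ ω β (xgen 𝕜 m n ξ) hb hc hd)
    (hind : ∀ N₁ N₂ : Submodule (H 𝕜 m n ξ) M, IsCompl N₁ N₂ → N₁ = ⊥ ∨ N₂ = ⊥)
    (hE : nilCasimir M m ξ ω (xgen 𝕜 m n ξ) hb hc hd ≠ 0) :
    ∃ (l : ℕ) (hl1 : 1 ≤ l) (hl2 : l ≤ n - 1) (i : ℕ), i < m * n ∧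
      ∃ v u : Fin n → M, IsPrep 𝕜 m n ξ l hl1 (by omega) (i : ℤ) v u := by
  obtain ⟨i, l, v, u, hi, hr, hv, hu, hEu, hxu, hDu, hDu', hli, hspan⟩ :=
    h.exists_projective_basis hind hE
  have hch := h.chain
  have hpos := hr.pos
  have hlt := hr.lt
  have hq0 : ξ ^ m ≠ 0 := pow_ne_zero _ h.ne_zero
  have hqn : (ξ ^ m) ^ (n : ℤ) = 1 := by rw [zpow_natCast, h.prim_pow.pow_eq_one]
  obtain ⟨hβ, hω⟩ := scalars_of_roots 𝕜 (i := i) h.ne_zero h.one_sub_ne_zero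
    (h.prim_pow.pow_ne_one_of_pos_of_lt hpos.ne' hlt)
    (by have := hr.root'; rwa [show (i : ℤ) + l - 1 - l = i - 1 by ring] at this) hr.root
  have hg := weightScalar_eq_qInt_mul 𝕜 h.ne_zero h.one_sub_ne_zero hβ hω
  set D := Algebra.lsmul 𝕜 𝕜 M hd with hD
  have hdD : ∀ w : M, hd • w = D w := fun w => rfl
  have hdpow : ∀ (k : ℕ) (w : M), hd ^ k • w = (D ^ k) w := fun k w => by
    rw [hD, ← map_pow]
    rfl
  have hD0 : ∀ {k : ℕ} (w : M), n ≤ k → (D ^ k) w = 0 := fun w hk => hch.D_pow_eq_zero hk w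
  have hDD : ∀ (j k : ℕ) (w : M), (D ^ j) ((D ^ k) w) = (D ^ (j + k)) w := fun j k w => by
    rw [pow_add, Module.End.mul_apply]
  have hvj : ∀ j : Fin n, (D ^ (j.rev : ℕ)) v ∈
      weightSpace M ξ hc (i - ((n : ℤ) - (l : ℤ)) + (j : ℕ)) := fun j => by
    have := hch.D_pow_mem hv (j.rev : ℕ)
    rwa [show (i : ℤ) + l - 1 - ((j.rev : ℕ) : ℤ) = i - ((n : ℤ) - (l : ℤ)) + (j : ℕ) by
      rw [Fin.val_rev]; omega] at this
  have huj : ∀ j : Fin n, (D ^ (j.rev : ℕ)) u ∈ weightSpace M ξ hc (i + (j : ℕ)) := fun j => by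
    have := hch.D_pow_mem hu (j.rev : ℕ)
    rwa [show (i : ℤ) + l - 1 + (n - l) - ((j.rev : ℕ) : ℤ) = i + (j : ℕ) by
      rw [Fin.val_rev]; omega] at this
  have hxv : ∀ {j : ℕ}, j + 1 < n → ha • (D ^ (n - (j + 1))) v =
      gam 𝕜 m n ξ l i (j + 1) • (D ^ (n - (j + 1 + 1))) v + (D ^ (n - l + (n - (j + 1 + 1)))) u := by
    intro j hj
    have h0 : hd ^ (n - 1) • (D ^ (n - (j + 1))) v = 0 := by rw [hdpow, hDD, hD0 _ (by omega)]
    have h1 := hch.X_D_pow_succ hv hDu' (n - (j + 1 + 1))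
    rw [show n - (j + 1 + 1) + 1 = n - (j + 1) by omega] at h1
    rw [ha_smul_eq_of_eq_zero 𝕜 h0, gam, if_neg (by omega), ← (hg (j + 1)).2]
    refine h1.trans ?_
    congr 2
    exact hch.periodic _ _ ⟨-1, by omega⟩
  refine ⟨l, hpos, by omega, i, hi, fun j => (D ^ (j.rev : ℕ)) v, fun j => (D ^ (j.rev : ℕ)) u,
    ?_, ?_, ?_, ?_, ?_, ?_, ?_, ?_, ?_, fun j => mem_weightSpace.mp (hvj j),
    fun j => mem_weightSpace.mp (huj j), ?_, ?_, ?_, ?_⟩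
  · have h1 := hli.comp (Sum.map Fin.rev Fin.rev)
      (Sum.map_injective.mpr ⟨Fin.rev_injective, Fin.rev_injective⟩)
    rwa [Sum.elim_comp_map] at h1
  · rw [← Set.Sum.elim_range, ← hspan, ← (Sum.map_surjective.mpr ⟨Fin.rev_surjective,
      Fin.rev_surjective⟩ : Function.Surjective (Sum.map (Fin.rev (n := n)) (Fin.rev (n := n)))
      ).range_comp, Sum.elim_comp_map]
    simp only [Function.comp_def, Fin.rev_rev]
  · intro j hj
    simp only [Fin.val_rev]
    rw [hxv (by omega), hD0 u (by omega), add_zero]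
  · intro j hj hjl
    simp only [Fin.val_rev]
    rw [hxv hj, show n - l + (n - (j + 1 + 1)) = n - (j + 1 + l - n + 1) by omega]
  · have h1 : (D ^ ((Fin.rev (⟨n - 1, by omega⟩ : Fin n) : Fin n) : ℕ)) v = v := by
      rw [Fin.val_rev, show n - (n - 1 + 1) = 0 by omega, pow_zero, Module.End.one_apply]
    have h2 := hvj ⟨0, by omega⟩
    rw [Fin.val_rev, zero_add, ← hdpow] at h2
    have h3 : (ξ ^ m) ^ ((i : ℤ) - ((n : ℤ) - (l : ℤ)) + ((0 : ℕ) : ℤ)) = (ξ ^ m) ^ ((i : ℤ) + l) := by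
      rw [show (i : ℤ) - ((n : ℤ) - (l : ℤ)) + ((0 : ℕ) : ℤ) = i + l - n by push_cast; ring,
        zpow_sub₀ hq0, hqn, div_one]
    have h4 : ξ ^ m * (β * (ξ ^ m) ^ (-((i : ℤ) - ((n : ℤ) - (l : ℤ)) + ((0 : ℕ) : ℤ)))) =
        (ξ ^ m) ^ (i : ℤ) := by
      rw [zpow_neg, h3, ← zpow_neg, hβ, ← zpow_add₀ hq0, ← zpow_one_add₀ hq0]
      congr 1
      ring
    simp only [h1]
    rw [ha_smul_eq 𝕜 h h2, h3, h4, ← hDu, gam, if_pos rfl, hdpow, add_comm]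
    simp only [Fin.val_rev, zero_add]
    rw [show n - (l + 1) = n - l - 1 by omega]
  · intro j hj
    simp only [Fin.val_rev]
    have h0 : hd ^ (n - 1) • (D ^ (n - (j + 1))) u = 0 := by rw [hdpow, hDD, hD0 _ (by omega)]
    have h1 := hch.X_D_pow_succ_of_E_eq_zero hu hEu (n - (j + 1 + 1))
    rw [show n - (j + 1 + 1) + 1 = n - (j + 1) by omega] at h1
    rw [ha_smul_eq_of_eq_zero 𝕜 h0, alph, if_neg (by omega), ← (hg (j + 1)).1]
    refine h1.trans ?_
    congr 2
    omega
  · have h1 : (D ^ ((Fin.rev (⟨n - 1, by omega⟩ : Fin n) : Fin n) : ℕ)) u = u := by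
      rw [Fin.val_rev, show n - (n - 1 + 1) = 0 by omega, pow_zero, Module.End.one_apply]
    have h2 := huj ⟨0, by omega⟩
    rw [Fin.val_rev, zero_add, ← hdpow, Nat.cast_zero, add_zero] at h2
    have h4 : ξ ^ m * (β * (ξ ^ m) ^ (-(i : ℤ))) = (ξ ^ m) ^ ((i : ℤ) + l) := by
      rw [hβ, ← zpow_add₀ hq0, ← zpow_one_add₀ hq0]
      congr 1
      ring
    simp only [h1]
    rw [ha_smul_eq 𝕜 h h2, h4, alph, if_pos rfl, hdpow, hxu, zero_add]
    simp only [Fin.val_rev, zero_add]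
  · intro j
    dsimp only
    rw [b_smul_of_mul_smul h.ne_zero h.scalar (hvj j), hβ, ← zpow_add₀ hq0]
    congr 2
    ring
  · intro j
    dsimp only
    rw [b_smul_of_mul_smul h.ne_zero h.scalar (huj j), hβ, ← zpow_add₀ hq0]
    congr 2
    ring
  · rw [hdD, ← Module.End.mul_apply, ← pow_succ', hD0 _ (by simp only [Fin.val_rev]; omega)]
  · intro j hj
    rw [hdD, ← Module.End.mul_apply, ← pow_succ']
    simp only [Fin.val_rev]
    rw [show n - (j + 1 + 1) + 1 = n - (j + 1) by omega]
  · rw [hdD, ← Module.End.mul_apply, ← pow_succ', hD0 _ (by simp only [Fin.val_rev]; omega)]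
  · intro j hj
    rw [hdD, ← Module.End.mul_apply, ← pow_succ']
    simp only [Fin.val_rev]
    rw [show n - (j + 1 + 1) + 1 = n - (j + 1) by omega]

section Simple

variable {K R M : Type*} [Field K] [Ring R] [Algebra K R] [AddCommGroup M] [Module K M]
  [Module R M] [IsScalarTower K R M]

namespace Chain

variable {n : ℕ} {X D E : Module.End K M} {W : ℤ → Submodule K M} {g : ℤ → K}

theorem D_X_pow_succ (h : Chain n X D E W g) (hE : E = 0) {t : ℤ} {w : M} (hw : w ∈ W t) (k : ℕ) :
    D ((X ^ (k + 1)) w) = g (t + k) • (X ^ k) w := by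
  rw [pow_succ', Module.End.mul_apply, h.DX (h.X_pow_mem hw k), hE, LinearMap.zero_apply, zero_add]

theorem D_pow_X_pow_eq_zero (h : Chain n X D E W g) (hE : E = 0) {t : ℤ} {w : M} (hw : w ∈ W t)
    (hD : D w = 0) {j k : ℕ} (hjk : j < k) : (D ^ k) ((X ^ j) w) = 0 := by
  have h1 := h.D_pow_X_pow hw 1 j (by simp [hE])
  rw [pow_one, hD, smul_zero] at h1
  rw [show k = k - (1 + j) + (1 + j) by omega, pow_add, Module.End.mul_apply, h1, map_zero]

end Chain

namespace DoubleModule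

variable {m n : ℕ} {ξ ω β : K} {x b c d : R}

theorem eq_top_of_stable [IsSimpleModule R M] (h : DoubleModule M m n ξ ω β x b c d)
    {N : Submodule K M} (hx : ∀ w ∈ N, x • w ∈ N) (hc' : ∀ w ∈ N, c • w ∈ N)
    (hd' : ∀ w ∈ N, d • w ∈ N) {v : M} (hv : v ∈ N) (hv0 : v ≠ 0) : N = ⊤ := by
  rcases eq_bot_or_eq_top (h.toSubmodule N hx hc' hd') with h1 | h1
  · have h2 : v ∈ h.toSubmodule N hx hc' hd' := hv
    rw [h1] at h2
    exact absurd h2 hv0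
  · rw [eq_top_iff]
    intro w _
    have h2 : w ∈ h.toSubmodule N hx hc' hd' := h1 ▸ Submodule.mem_top
    exact h2

theorem nilCasimir_eq_zero [IsSimpleModule R M] (h : DoubleModule M m n ξ ω β x b c d) :
    nilCasimir M m ξ ω x b c d = 0 := by
  have := IsSimpleModule.nontrivial R M
  have hcomm : ∀ (r : R) (w : M), nilCasimir M m ξ ω x b c d w = 0 →
      nilCasimir M m ξ ω x b c d (r • w) = 0 := by
    intro r w hw
    change casimir m ξ x b c d • w - ω • w = 0 at hw
    change casimir m ξ x b c d • r • w - ω • r • w = 0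
    rw [smul_smul, h.rel.casimir_comm h.ne_zero h.one_sub_ne_zero h.adjoin, mul_smul,
      smul_comm ω r w, ← smul_sub, hw, smul_zero]
  obtain ⟨v, hv, hv0⟩ : ∃ v, nilCasimir M m ξ ω x b c d v = 0 ∧ v ≠ 0 := by
    by_contra! hne
    obtain ⟨k, hk⟩ := h.nilpotent
    have hinj : Function.Injective (nilCasimir M m ξ ω x b c d) :=
      (injective_iff_map_eq_zero _).mpr hne
    have hinj' : Function.Injective ((nilCasimir M m ξ ω x b c d) ^ k) := by
      rw [Module.End.coe_pow]
      exact hinj.iterate k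
    obtain ⟨w, hw⟩ := exists_ne (0 : M)
    exact hw (hinj' (by rw [hk, LinearMap.zero_apply, LinearMap.zero_apply]))
  exact LinearMap.ker_eq_top.mp (h.eq_top_of_stable (N := LinearMap.ker _)
    (hcomm x) (hcomm c) (hcomm d) hv hv0)

theorem span_X_pow_eq_top [IsSimpleModule R M] (h : DoubleModule M m n ξ ω β x b c d) {t : ℤ}
    {w : M} (hw : w ∈ weightSpace M ξ c t) (hdw : d • w = 0) (hw0 : w ≠ 0) :
    Submodule.span K
      (Set.range fun s : Fin n => ((Algebra.lsmul K K M x) ^ (s : ℕ)) w) = ⊤ := by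
  have hch := h.chain
  have hn := h.one_lt_n
  have mem : ∀ k : ℕ, ((Algebra.lsmul K K M x) ^ k) w ∈ Submodule.span K
      (Set.range fun s : Fin n => ((Algebra.lsmul K K M x) ^ (s : ℕ)) w) := by
    intro k
    by_cases hk : k < n
    · exact Submodule.subset_span ⟨⟨k, hk⟩, rfl⟩
    · rw [hch.X_pow_eq_zero (by omega)]
      exact Submodule.zero_mem _
  refine h.eq_top_of_stable (smul_mem_span fun s => ?_)
    (c_smul_mem_span (ξ := ξ) (fun s => t + (s : ℕ)) fun s => hch.X_pow_mem hw s)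
    (smul_mem_span fun s => ?_) (mem 0) (by simpa using hw0)
  · have := mem (s + 1)
    rwa [pow_succ', Module.End.mul_apply] at this
  · rcases s with ⟨_ | s, hs⟩
    · simp [hdw]
    · have := Submodule.smul_mem _ (weightScalar m ξ ω β (t + s)) (mem s)
      rwa [← hch.D_X_pow_succ h.nilCasimir_eq_zero hw] at this

theorem exists_weight_vector [Nontrivial M] (h : DoubleModule M m n ξ ω β x b c d) :
    ∃ (i : ℕ) (z : M), i < m * n ∧ z ∈ weightSpace M ξ c i ∧ d • z = 0 ∧ z ≠ 0 := by
  have hch := h.chain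
  obtain ⟨t, w, hw, hw0⟩ : ∃ t, ∃ w ∈ weightSpace M ξ c t, w ≠ 0 := by
    by_contra! hne
    obtain ⟨w, hw⟩ := exists_ne (0 : M)
    refine hw ?_
    have h1 : w ∈ ⨆ t, weightSpace M ξ c t := h.iSup_weightSpace ▸ Submodule.mem_top
    rwa [show ⨆ t, weightSpace M ξ c t = ⊥ from
      iSup_eq_bot.mpr fun t => (Submodule.eq_bot_iff _).mpr (hne t), Submodule.mem_bot] at h1
  classical
  have hex : ∃ k : ℕ, ((Algebra.lsmul K K M d) ^ k) w = 0 := ⟨n, hch.D_pow_eq_zero le_rfl w⟩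
  have hpos : Nat.find hex ≠ 0 := by
    intro h0
    have := Nat.find_spec hex
    rw [h0, pow_zero] at this
    exact hw0 this
  obtain ⟨k, hk⟩ := Nat.exists_eq_succ_of_ne_zero hpos
  have hz := hch.D_pow_mem hw k
  have hmn : (0 : ℤ) < ((m * n : ℕ) : ℤ) := by exact_mod_cast h.mul_pos
  have h1 := Int.emod_nonneg (t - k) hmn.ne'
  have h2 := Int.emod_lt_of_pos (t - k) hmn
  refine ⟨((t - k) % ((m * n : ℕ) : ℤ)).toNat, _, by omega, ?_, ?_,
    Nat.find_min hex (m := k) (by omega)⟩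
  · rwa [Int.toNat_of_nonneg h1,
      weightSpace_congr h.prim h.ne_zero (Int.mod_modEq (t - k) _).symm.dvd]
  · have := Nat.find_spec hex
    rw [hk, Nat.succ_eq_add_one, pow_succ', Module.End.mul_apply] at this
    exact this

theorem exists_simple_basis [IsSimpleModule R M] (h : DoubleModule M m n ξ ω β x b c d) :
    ∃ (i l : ℕ) (z : M), i < m * n ∧ 0 < l ∧ l ≤ n ∧ z ∈ weightSpace M ξ c i ∧ d • z = 0 ∧
      weightScalar m ξ ω β (i - 1) = 0 ∧ (l < n → weightScalar m ξ ω β (i + l - 1) = 0) ∧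
      ((Algebra.lsmul K K M x) ^ l) z = 0 ∧
      (∀ k, k + 1 < l → weightScalar m ξ ω β (i + k) ≠ 0) ∧
      LinearIndependent K (fun s : Fin l => ((Algebra.lsmul K K M x) ^ (s : ℕ)) z) ∧
      Submodule.span K
        (Set.range fun s : Fin l => ((Algebra.lsmul K K M x) ^ (s : ℕ)) z) = ⊤ := by
  have := IsSimpleModule.nontrivial R M
  have hch := h.chain
  have hn := h.one_lt_n
  have h2n := h.two_mul_le
  have hE := h.nilCasimir_eq_zero
  obtain ⟨i, z, hi, hz, hdz, hz0⟩ := h.exists_weight_vector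
  have hDz : (Algebra.lsmul K K M d) z = 0 := hdz
  classical
  have hex : ∃ k : ℕ, ((Algebra.lsmul K K M x) ^ k) z = 0 := ⟨n, hch.X_pow_eq_zero le_rfl z⟩
  obtain ⟨l, hl⟩ : ∃ l, l = Nat.find hex := ⟨_, rfl⟩
  have hl0 : ((Algebra.lsmul K K M x) ^ l) z = 0 := hl ▸ Nat.find_spec hex
  have hlk : ∀ k, k < l → ((Algebra.lsmul K K M x) ^ k) z ≠ 0 := fun k hk =>
    Nat.find_min hex (hl ▸ hk)
  have hln : l ≤ n := hl ▸ Nat.find_min' hex (hch.X_pow_eq_zero le_rfl z)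
  have hpos : 0 < l := by
    by_contra h0
    rw [show l = 0 by omega, pow_zero] at hl0
    exact hz0 hl0
  refine ⟨i, l, z, hi, hpos, hln, hz, hdz, ?_, fun _ => ?_, hl0, fun k hk hg => ?_, ?_, ?_⟩
  · have h1 := hch.XD hz
    rw [hDz, map_zero, hE, LinearMap.zero_apply, zero_add] at h1
    exact (smul_eq_zero.mp h1.symm).resolve_right hz0
  · have h1 := hch.D_X_pow_succ hE hz (l - 1)
    rw [show l - 1 + 1 = l by omega, hl0, map_zero] at h1
    rw [show (i : ℤ) + l - 1 = i + ((l - 1 : ℕ) : ℤ) by omega]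
    exact (smul_eq_zero.mp h1.symm).resolve_right (hlk _ (by omega))
  · have hD := hch.D_X_pow_succ hE hz k
    rw [hg, zero_smul] at hD
    have hmem := hch.X_pow_mem hz (k + 1)
    have htop := h.span_X_pow_eq_top hmem hD (hlk _ hk)
    have hle : Submodule.span K (Set.range fun s : Fin n =>
        ((Algebra.lsmul K K M x) ^ (s : ℕ)) (((Algebra.lsmul K K M x) ^ (k + 1)) z)) ≤
        LinearMap.ker (Algebra.lsmul K K M (weightProj (m * n) ξ c i)) := by
      rw [Submodule.span_le]
      rintro _ ⟨s, rfl⟩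
      exact weightProj_smul_of_not_dvd h.prim h.mul_pos (hch.X_pow_mem hmem s)
        (not_dvd_of_lt (by omega) (by omega) (by omega))
    rw [htop] at hle
    have h1 : weightProj (m * n) ξ c i • z = 0 := hle Submodule.mem_top
    rw [weightProj_smul_of_dvd h.prim h.mul_pos hz (by simp)] at h1
    exact hz0 h1
  · rw [Fintype.linearIndependent_iff]
    intro a h0 s
    have h1 := h.weightProj_smul_sum (τ := fun s : Fin l => (i : ℤ) + (s : ℕ))
      (fun s => hch.X_pow_mem hz s)
      (fun s t hst => not_dvd_of_lt (by have := Fin.val_ne_of_ne hst; omega) (by omega) (by omega))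
      a s
    rw [h0, smul_zero] at h1
    exact (smul_eq_zero.mp h1.symm).resolve_right (hlk _ s.2)
  · rw [← top_le_iff, ← h.span_X_pow_eq_top hz hdz hz0, Submodule.span_le]
    rintro _ ⟨s, rfl⟩
    by_cases hs : (s : ℕ) < l
    · exact Submodule.subset_span ⟨⟨s, hs⟩, rfl⟩
    · dsimp only
      rw [show (s : ℕ) = (s - l) + l by omega, pow_add, Module.End.mul_apply, hl0, map_zero]
      exact Submodule.zero_mem _

end DoubleModule

end Simple

section Semisimple

theorem isSimpleModule_of_radM_eq_bot (hm : 1 < m) (hn : 1 < n)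
    (hξ : IsPrimitiveRoot ξ (m * n)) {M : Type} [AddCommGroup M] [Module (H 𝕜 m n ξ) M]
    (hM : Indec 𝕜 m n ξ M) (hrad : radM 𝕜 m n ξ M = ⊥) :
    IsSimpleModule (H 𝕜 m n ξ) M := by
  have := hM.1
  have := isSemisimpleModule_of_radM_eq_bot 𝕜 hm hn hξ M hrad
  rw [isSimpleModule_iff]
  refine ⟨fun N => ?_⟩
  obtain ⟨N', hN⟩ := exists_isCompl N
  rcases hM.2 _ _ hN with h0 | h0
  · exact Or.inl h0
  · rw [h0] at hN
    exact Or.inr (eq_top_of_isCompl_bot hN)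

variable {M : Type} [AddCommGroup M] [Module 𝕜 M] [Module (H 𝕜 m n ξ) M]
  [IsScalarTower 𝕜 (H 𝕜 m n ξ) M]

theorem isMrep_or_isZrep {ω β : 𝕜} (h : DoubleModule M m n ξ ω β (xgen 𝕜 m n ξ) hb hc hd)
    [IsSimpleModule (H 𝕜 m n ξ) M] (hβ : β ^ (m * n) = 1) :
    (∃ l i : ℕ, 1 ≤ l ∧ l ≤ n - 1 ∧ i < m * n ∧
      ∃ mv : Fin l → M, IsMrep 𝕜 m n ξ l (i : ℤ) mv) ∨
    (∃ i j : ℕ, i < m * n ∧ j < m * n ∧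
      (∀ k : ℕ, k ≤ n - 2 → (ξ ^ m) ^ ((i : ℤ) + k) ≠ ξ ^ (j : ℤ)) ∧
      IsZrep 𝕜 m n ξ (i : ℤ) (j : ℤ) M) := by
  obtain ⟨i, l, z, hi, hpos, hln, hz, hdz, hg0, hgl, hl0, hg, hli, hsp⟩ := h.exists_simple_basis
  have hch := h.chain
  have hE := h.nilCasimir_eq_zero
  have hn := h.one_lt_n
  have hmn := h.mul_pos
  have hξ0 := h.ne_zero
  have hq0 : ξ ^ m ≠ 0 := pow_ne_zero _ hξ0
  have hax : ∀ {k : ℕ}, k + 1 < n →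
      ha • ((Algebra.lsmul 𝕜 𝕜 M (xgen 𝕜 m n ξ)) ^ k) z =
        ((Algebra.lsmul 𝕜 𝕜 M (xgen 𝕜 m n ξ)) ^ (k + 1)) z := by
    intro k hk
    have h0 := hch.D_pow_X_pow_eq_zero hE hz hdz (j := k) (k := n - 1) (by omega)
    rw [← map_pow] at h0
    rw [ha_smul_eq_of_eq_zero 𝕜 h0, pow_succ', Module.End.mul_apply]
    rfl
  rcases hln.lt_or_eq with hlt | h_eq
  · left
    obtain ⟨hβ', hω⟩ := scalars_of_roots 𝕜 (l := l) hξ0 h.one_sub_ne_zero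
      (h.prim_pow.pow_ne_one_of_pos_of_lt hpos.ne' hlt) hg0 (hgl hlt)
    have hα : ∀ j : ℕ, j + 1 < l → alph 𝕜 m n ξ l i (j + 1) = weightScalar m ξ ω β (i + j) := by
      intro j hj
      rw [alph, if_neg (by omega),
        ← (weightScalar_eq_qInt_mul 𝕜 hξ0 h.one_sub_ne_zero hβ' hω (j + 1)).1]
      congr 1
      omega
    let p : ℕ → 𝕜 := fun k => (∏ s ∈ Finset.range k, weightScalar m ξ ω β (i + s))⁻¹
    have hp : ∀ s : Fin l, IsUnit (p s) := fun s => (isUnit_iff_ne_zero.mpr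
      (inv_ne_zero (Finset.prod_ne_zero_iff.mpr fun k hk => hg k
        (by have := Finset.mem_range.mp hk; omega))))
    have hp1 : ∀ j : ℕ, j + 1 < l → p j = weightScalar m ξ ω β (i + j) * p (j + 1) := by
      intro j hj
      have := hg j hj
      simp only [p, Finset.prod_range_succ]
      field_simp
    let B := (Module.Basis.mk hli hsp.ge).isUnitSMul hp
    have hB : ∀ s : Fin l, B s = p s • ((Algebra.lsmul 𝕜 𝕜 M (xgen 𝕜 m n ξ)) ^ (s : ℕ)) z :=
      fun s => by rw [Module.Basis.isUnitSMul_apply, Module.Basis.mk_apply]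
    have hBw : ∀ s : Fin l, B s ∈ weightSpace M ξ hc (i + (s : ℕ)) := fun s => by
      rw [hB]
      exact Submodule.smul_mem _ _ (hch.X_pow_mem hz s)
    refine ⟨l, i, hpos, by omega, hi, B, B.linearIndependent, B.span_eq, ?_, ?_, fun j => ?_,
      fun j => mem_weightSpace.mp (hBw j), ?_, fun _ => ?_⟩
    · intro j hj
      rw [hB, hB, smul_comm, hax (by omega), hα j hj, smul_smul, ← hp1 j hj]
    · intro j hj hjl
      rw [hB, smul_comm, hax (by simp only; omega)]
      simp only [hjl, hl0, smul_zero]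
    · rw [b_smul_of_mul_smul hξ0 h.scalar (hBw j), hβ', ← zpow_add₀ hq0]
      congr 2
      ring
    · intro j hj
      have hD : hd • ((Algebra.lsmul 𝕜 𝕜 M (xgen 𝕜 m n ξ)) ^ (j + 1)) z =
        weightScalar m ξ ω β (i + j) • ((Algebra.lsmul 𝕜 𝕜 M (xgen 𝕜 m n ξ)) ^ j) z :=
        hch.D_X_pow_succ hE hz j
      rw [hB, hB, smul_comm, hD, smul_smul, hp1 j hj, mul_comm]
    · rw [hB, smul_comm, pow_zero, Module.End.one_apply, hdz, smul_zero]
  · right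
    subst l
    have hqj : (β * (ξ ^ m) ^ (-(i : ℤ))) ^ (m * n) = 1 := by
      rw [mul_pow, hβ, one_mul, ← zpow_natCast _ (m * n), zpow_comm, zpow_natCast, pow_right_comm,
        h.prim.pow_eq_one, one_pow, one_zpow]
    have : NeZero (m * n) := ⟨hmn.ne'⟩
    obtain ⟨j, hj, hjξ⟩ := h.prim.eq_pow_of_pow_eq_one hqj
    have hak : ∀ k : ℕ, k < n → ha ^ k • z = ((Algebra.lsmul 𝕜 𝕜 M (xgen 𝕜 m n ξ)) ^ k) z := by
      intro k
      induction k with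
      | zero => simp
      | succ k ih =>
        intro hk
        rw [pow_succ', mul_smul, ih (by omega), hax hk]
    have hfun : (fun k : Fin n => ha ^ (k : ℕ) • z) =
        fun k : Fin n => ((Algebra.lsmul 𝕜 𝕜 M (xgen 𝕜 m n ξ)) ^ (k : ℕ)) z :=
      funext fun k => hak k k.2
    refine ⟨i, j, hi, hj, fun k hk h0 => hg k (by omega) ?_, z, hdz, ?_, mem_weightSpace.mp hz,
      ?_, ?_⟩
    · rw [weightScalar_eq_zero_iff hξ0 h.one_sub_ne_zero] at hg0 ⊢
      rw [zpow_natCast, hjξ, zpow_neg] at h0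
      rw [zpow_sub_one₀ hq0] at hg0
      rw [zpow_add₀ hq0] at h0 ⊢
      have hy : (ξ ^ m) ^ (i : ℤ) ≠ 0 := zpow_ne_zero _ hq0
      generalize ω * (1 - ξ ^ m) = s at *
      generalize (ξ ^ m) ^ (i : ℤ) = y at *
      generalize (ξ ^ m) ^ (k : ℤ) = u at *
      generalize ξ ^ m = q at *
      have hβ2 : β = y ^ 2 * u := by
        rw [← div_eq_mul_inv, eq_div_iff hy] at h0
        rw [← h0]
        ring
      rw [hβ2] at hg0 ⊢
      field_simp at hg0
      linear_combination (y * u) * hg0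
    · rw [b_smul_of_mul_smul hξ0 h.scalar hz, ← hjξ, zpow_natCast]
    · rw [hfun]
      exact hli
    · rw [hfun]
      exact hsp

theorem nilCasimir_ne_zero_of_rad2M_ne_bot {ω β : 𝕜}
    (h : DoubleModule M m n ξ ω β (xgen 𝕜 m n ξ) hb hc hd) (hrad : rad2M 𝕜 m n ξ M ≠ ⊥) :
    nilCasimir M m ξ ω (xgen 𝕜 m n ξ) hb hc hd ≠ 0 := by
  refine fun hE => hrad (Submodule.span_eq_bot.mpr ?_)
  rintro _ ⟨r, hr, s, hs, w, rfl⟩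
  rw [jrad, Ideal.jacobson_bot] at hr hs
  exact h.jacobson_smul_jacobson_smul hE hr hs w

end Semisimple

/-- Lemma 3.12: a finite dimensional indecomposable `H_{mn}(ξ)`-module of
Loewy length 1 is isomorphic to some `M(l,i)` or some `Z(λ_{ij})` with `(i,j) ∈ I_0`; one of
Loewy length 3 is isomorphic to some `P(l,i)`. -/
theorem statement11 (𝕜 : Type) [Field 𝕜] [IsAlgClosed 𝕜] (m n : ℕ) (hm : 1 < m) (hn : 1 < n)
    (ξ : 𝕜) (hξ : IsPrimitiveRoot ξ (m * n))
    (M : Type) [AddCommGroup M] [Module 𝕜 M] [Module (H 𝕜 m n ξ) M]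
    [IsScalarTower 𝕜 (H 𝕜 m n ξ) M] [FiniteDimensional 𝕜 M]
    (hindec : Indec 𝕜 m n ξ M) :
    (radM 𝕜 m n ξ M = ⊥ →
      (∃ l i : ℕ, 1 ≤ l ∧ l ≤ n - 1 ∧ i < m * n ∧
        ∃ mv : Fin l → M, IsMrep 𝕜 m n ξ l (i : ℤ) mv) ∨
      (∃ i j : ℕ, i < m * n ∧ j < m * n ∧
        (∀ k : ℕ, k ≤ n - 2 → (ξ ^ m) ^ ((i : ℤ) + k) ≠ ξ ^ (j : ℤ)) ∧
        IsZrep 𝕜 m n ξ (i : ℤ) (j : ℤ) M)) ∧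
    (rad2M 𝕜 m n ξ M ≠ ⊥ → rad3M 𝕜 m n ξ M = ⊥ →
      ∃ (l : ℕ) (hl1 : 1 ≤ l) (hl2 : l ≤ n - 1) (i : ℕ), i < m * n ∧
        ∃ v u : Fin n → M, IsPrep 𝕜 m n ξ l hl1 (by omega) (i : ℤ) v u) := by
  obtain ⟨ω, β, hβ, h⟩ := exists_doubleModule 𝕜 hm hn hξ hindec
  refine ⟨fun hrad => ?_, fun hrad _ => ?_⟩
  · have := isSimpleModule_of_radM_eq_bot 𝕜 hm hn hξ hindec hrad
    exact isMrep_or_isZrep 𝕜 h hβ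
  · exact exists_isPrep 𝕜 h hindec.2 (nilCasimir_ne_zero_of_rad2M_ne_bot 𝕜 h hrad)

end Radford
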